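/- arXiv:1008.4113 — 3 statements merged into one kernel-verified Lean document; each statement's English description precedes it below -/
import Mathlib

section
/- Hölder continuity of the operator family R(z): let (Y,μ) be a probability space, φ : Y → {1,2,3,…} measurable with μ(φ > n) = ℓ(n)n^{−β} for all n ≥ 1, where β ∈ (0,1] and ℓ is slowly varying; let 𝓑 be a complex Banach space and (R_n)_{n≥1} bounded operators on 𝓑 with ‖R_n‖ ≤ C μ(φ = n) for some constant C > 0; set R(z) = Σ_{n≥1} zⁿ R_n for z in the closed unit disk; and set m(x) = ℓ(x) if β ∈ (0,1) and m(x) = Σ_{j=1}^{⌊x⌋} ℓ(j)/j if β = 1. Then there is a constant C′ > 0 such that ‖R(ρe^{i(θ+h)}) − R(ρe^{iθ})‖ ≤ C′ m(1/h) h^β for all θ ∈ [0,2π), ρ ∈ (0,1], h ∈ (0,1], and ‖R(ρ) − R(1)‖ ≤ C′ m(1/(1−ρ)) (1−ρ)^β for all ρ ∈ (0,1). -/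
open MeasureTheory Filter Topology

/-- `l` is slowly varying: measurable, bounded above and below by positive constants on
each compact subset of `(0,∞)`, and `l (λ x)/ l x → 1` as `x → ∞` for every `λ > 0`. -/
def SlowlyVarying (l : ℝ → ℝ) : Prop :=
  Measurable l ∧
  (∀ K : Set ℝ, IsCompact K → K ⊆ Set.Ioi 0 →
    ∃ c C : ℝ, 0 < c ∧ ∀ x ∈ K, c ≤ l x ∧ l x ≤ C) ∧
  ∀ lam : ℝ, 0 < lam → Tendsto (fun x => l (lam * x) / l x) atTop (𝓝 1)

lemma sv_pos {l : ℝ → ℝ} (hl : SlowlyVarying l) {x : ℝ} (hx : 0 < x) : 0 < l x := by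
  obtain ⟨c, C, hc, h⟩ := hl.2.1 {x} isCompact_singleton (by simpa using hx)
  exact lt_of_lt_of_le hc (h x rfl).1

lemma sv_shift_measure {f : ℝ → ℝ} (hf : Measurable f)
    (hlim : ∀ t : ℝ, Tendsto (fun u => f (u + t) - f u) atTop (𝓝 0))
    {u : ℕ → ℝ} (hu : Tendsto u atTop atTop) :
    Tendsto (fun n => (volume.restrict (Set.Icc (0:ℝ) 2))
      {s | (1:ℝ) ≤ ‖(f (u n + s) - f (u n)) - 0‖}) atTop (𝓝 0) := by
  have h := tendstoInMeasure_of_tendsto_ae (μ := volume.restrict (Set.Icc (0:ℝ) 2))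
    (f := fun n s => f (u n + s) - f (u n)) (g := fun _ => (0:ℝ))
    (fun n => by
      apply Measurable.aestronglyMeasurable
      fun_prop)
    (Eventually.of_forall fun s => (hlim s).comp hu)
  rw [tendstoInMeasure_iff_norm] at h
  exact h 1 one_pos

lemma sv_uniform {f : ℝ → ℝ} (hf : Measurable f)
    (hlim : ∀ t : ℝ, Tendsto (fun u => f (u + t) - f u) atTop (𝓝 0)) :
    ∃ U : ℝ, ∀ u, U ≤ u → ∀ t, 0 ≤ t → t ≤ 1 → |f (u + t) - f u| ≤ 2 := by
  by_contra hcon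
  push Not at hcon
  choose u hu t ht0 ht1 hbad using fun n : ℕ => hcon n
  have hut : Tendsto u atTop atTop :=
    tendsto_atTop_mono hu tendsto_natCast_atTop_atTop
  have hvt : Tendsto (fun n => u n + t n) atTop atTop :=
    tendsto_atTop_mono (fun n => by linarith [hu n, ht0 n]) tendsto_natCast_atTop_atTop
  have h1 := sv_shift_measure hf hlim hut
  have h2 := sv_shift_measure hf hlim hvt
  have hhalf : (0 : ENNReal) < 1/2 := by norm_num
  obtain ⟨n, hn1, hn2⟩ := ((h1.eventually_lt_const hhalf).and
    (h2.eventually_lt_const hhalf)).exists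
  rw [Measure.restrict_apply' measurableSet_Icc] at hn1 hn2
  set A := {s | (1:ℝ) ≤ ‖(f (u n + s) - f (u n)) - 0‖} ∩ Set.Icc (0:ℝ) 2 with hA
  set B := {s | (1:ℝ) ≤ ‖(f (u n + t n + s) - f (u n + t n)) - 0‖} ∩ Set.Icc (0:ℝ) 2 with hB
  have hsub : Set.Icc (1:ℝ) 2 ⊆ A ∪ (fun s => s + (- t n)) ⁻¹' B := by
    intro s hs
    by_contra hns
    simp only [Set.mem_union, not_or] at hns
    obtain ⟨ha, hb⟩ := hns
    have ha' : |f (u n + s) - f (u n)| < 1 := by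
      by_contra hh
      apply ha
      refine ⟨?_, by linarith [hs.1], hs.2⟩
      simpa using hh
    have hb' : |f (u n + s) - f (u n + t n)| < 1 := by
      by_contra hh
      apply hb
      refine ⟨?_, by linarith [hs.1, ht1 n], by linarith [hs.2, ht0 n]⟩
      have : u n + t n + (s + - t n) = u n + s := by ring
      simp only [Set.mem_setOf_eq, this]
      simpa using hh
    have := hbad n
    rw [abs_lt] at ha' hb'
    rcases lt_abs.1 this with h | h <;> linarith [ha'.1, ha'.2, hb'.1, hb'.2]
  have hle := (measure_mono (μ := volume) hsub).trans (measure_union_le _ _)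
  rw [measure_preimage_add_right, Real.volume_Icc] at hle
  have h3 := ENNReal.add_lt_add hn1 hn2
  rw [ENNReal.add_halves] at h3
  have : ENNReal.ofReal (2 - 1) = 1 := by norm_num
  rw [this] at hle
  exact absurd (lt_of_le_of_lt hle h3) (lt_irrefl _)

/-- eventually uniform comparison on multiplicative scale -/
lemma sv_comp {l : ℝ → ℝ} (hl : SlowlyVarying l) :
    ∃ X : ℝ, 1 ≤ X ∧ ∀ x, X ≤ x → ∀ z, x ≤ z → z ≤ 2 * x → l x ≤ Real.exp 2 * l z := by
  obtain ⟨U, hU⟩ := sv_uniform (f := fun u => Real.log (l (Real.exp u)))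
    (Real.measurable_log.comp (hl.1.comp Real.measurable_exp)) (by
      intro t
      have h1 := (hl.2.2 (Real.exp t) (Real.exp_pos t)).comp Real.tendsto_exp_atTop
      have h2 := ((Real.continuousAt_log one_ne_zero).tendsto).comp h1
      rw [Real.log_one] at h2
      refine h2.congr fun u => ?_
      simp only [Function.comp]
      rw [Real.log_div (sv_pos hl (by positivity)).ne' (sv_pos hl (by positivity)).ne',
        Real.exp_add, mul_comm (Real.exp u)])
  refine ⟨max 1 (Real.exp U), le_max_left _ _, ?_⟩
  intro x hx z hxz hz
  have hx1 : 1 ≤ x := (le_max_left _ _).trans hx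
  have hx0 : 0 < x := by linarith
  have hz0 : 0 < z := by linarith
  have hUx : U ≤ Real.log x := by
    rw [Real.le_log_iff_exp_le hx0]; exact (le_max_right _ _).trans hx
  have h := hU (Real.log x) hUx (Real.log z - Real.log x)
    (by linarith [Real.log_le_log hx0 hxz])
    (by
      have := Real.log_le_log hz0 hz
      rw [Real.log_mul two_ne_zero hx0.ne'] at this
      linarith [Real.log_two_lt_d9])
  simp only [add_sub_cancel, Real.exp_log hx0, Real.exp_log hz0] at h
  have h4 : Real.log (l x) ≤ 2 + Real.log (l z) := by linarith [(abs_le.1 h).1]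
  have := Real.exp_le_exp.2 h4
  rwa [Real.exp_add, Real.exp_log (sv_pos hl hx0), Real.exp_log (sv_pos hl hz0)] at this

lemma sv_potter {l : ℝ → ℝ} (hl : SlowlyVarying l) {ε : ℝ} (hε : 0 < ε) :
    ∃ K : ℝ, 0 < K ∧ ∀ y z, 1 ≤ y → y ≤ z → l y * y ^ ε ≤ K * (l z * z ^ ε) := by
  obtain ⟨X₁, hX₁, hcomp⟩ := sv_comp hl
  have hev : ∀ᶠ x in atTop, (2:ℝ) ^ (-ε) < l (2 * x) / l x :=
    (hl.2.2 2 two_pos).eventually_const_lt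
      (Real.rpow_lt_one_of_one_lt_of_neg one_lt_two (by linarith))
  obtain ⟨X₂, hX₂⟩ := eventually_atTop.1 hev
  set X := max X₁ X₂ with hX
  have hX1 : 1 ≤ X := hX₁.trans (le_max_left _ _)
  have hdbl : ∀ y, X ≤ y → l y * y ^ ε ≤ l (2 * y) * (2 * y) ^ ε := by
    intro y hy
    have hy0 : 0 < y := by linarith
    have h := hX₂ y ((le_max_right _ _).trans hy)
    rw [lt_div_iff₀ (sv_pos hl hy0)] at h
    rw [Real.mul_rpow two_pos.le hy0.le, ← mul_assoc]
    apply mul_le_mul_of_nonneg_right _ (by positivity)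
    have h2 : (0:ℝ) < 2 ^ ε := by positivity
    calc l y = (2:ℝ) ^ (-ε) * l y * 2 ^ ε := by
          rw [Real.rpow_neg two_pos.le]; field_simp
      _ ≤ l (2 * y) * 2 ^ ε := mul_le_mul_of_nonneg_right h.le h2.le
  have key : ∀ k : ℕ, ∀ y z, X ≤ y → y ≤ z → z ≤ 2 ^ k * y →
      l y * y ^ ε ≤ Real.exp 2 * (l z * z ^ ε) := by
    intro k
    induction k with
    | zero =>
      intro y z hy hyz hz
      have : z = y := le_antisymm (by simpa using hz) hyz
      subst this
      have h0 : 0 < z := by linarith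
      have : 0 < l z * z ^ ε := mul_pos (sv_pos hl h0) (by positivity)
      nlinarith [Real.add_one_le_exp (2:ℝ)]
    | succ k ih =>
      intro y z hy hyz hz
      have h0 : 0 < y := by linarith
      have hz0 : 0 < z := by linarith
      by_cases h2 : z ≤ 2 * y
      · rw [← mul_assoc]
        apply mul_le_mul (hcomp y ((le_max_left _ _).trans hy) z hyz h2)
          (Real.rpow_le_rpow h0.le hyz hε.le) (by positivity)
        have := sv_pos hl hz0
        positivity
      · refine (hdbl y hy).trans (ih (2 * y) z (by linarith) (by linarith) ?_)
        rw [pow_succ] at hz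
        linarith
  have key' : ∀ y z, X ≤ y → y ≤ z → l y * y ^ ε ≤ Real.exp 2 * (l z * z ^ ε) := by
    intro y z hy hyz
    have h0 : 0 < y := by linarith
    obtain ⟨k, hk⟩ := pow_unbounded_of_one_lt (z / y) (one_lt_two)
    rw [div_lt_iff₀ h0] at hk
    exact key k y z hy hyz hk.le
  obtain ⟨c, M, hc, hcM⟩ := hl.2.1 (Set.Icc 1 X) isCompact_Icc
    (fun x hx => lt_of_lt_of_le one_pos hx.1)
  have hE : 0 < Real.exp 2 := Real.exp_pos 2
  have hE1 : 1 ≤ Real.exp 2 := by linarith [Real.add_one_le_exp (2:ℝ)]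
  have hXe : 1 ≤ X ^ ε := Real.one_le_rpow hX1 hε.le
  have hcMX := hcM X ⟨hX1, le_rfl⟩
  have hM : 0 < M := by linarith
  -- lower bound
  have hlow : ∀ z, 1 ≤ z → c ≤ Real.exp 2 * (l z * z ^ ε) := by
    intro z hz
    by_cases h : z ≤ X
    · have h1 := (hcM z ⟨hz, h⟩).1
      have h2 : 1 ≤ z ^ ε := Real.one_le_rpow hz hε.le
      have h3 : c ≤ l z * z ^ ε := by nlinarith
      nlinarith
    · have := key' X z le_rfl (by linarith)
      nlinarith
  refine ⟨Real.exp 2 + M * X ^ ε / c * Real.exp 2, by positivity, ?_⟩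
  intro y z hy hyz
  have hz0 : 0 < z := by linarith
  have hzp : 0 < l z * z ^ ε := mul_pos (sv_pos hl hz0) (by positivity)
  have hq : 0 < M * X ^ ε / c := by positivity
  by_cases h : X ≤ y
  · have := key' y z h hyz
    have h5 : 0 < M * X ^ ε / c * Real.exp 2 * (l z * z ^ ε) := by positivity
    linarith
  · have h1 := (hcM y ⟨hy, by linarith⟩).2
    have h2 : y ^ ε ≤ X ^ ε := Real.rpow_le_rpow (by linarith) (by linarith) hε.le
    have h3 : l y * y ^ ε ≤ M * X ^ ε :=
      mul_le_mul h1 h2 (by positivity) hM.le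
    have h4 : M * X ^ ε ≤ M * X ^ ε / c * (Real.exp 2 * (l z * z ^ ε)) := by
      calc M * X ^ ε = M * X ^ ε / c * c := by field_simp
        _ ≤ _ := mul_le_mul_of_nonneg_left (hlow z (by linarith)) hq.le
    have h5 : 0 < Real.exp 2 * (l z * z ^ ε) := by positivity
    linarith

lemma sum_rpow_bd {ε : ℝ} (hε : 0 < ε) (hε1 : ε ≤ 1) (N : ℕ) :
    ∑ j ∈ Finset.Icc 1 N, (j:ℝ) ^ (ε - 1) ≤ (N:ℝ) ^ ε / ε := by
  induction N with
  | zero => simp [Real.zero_rpow hε.ne']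
  | succ n ih =>
    rw [Finset.sum_Icc_succ_top (by omega)]
    have hn : (0:ℝ) < (n+1:ℕ) := by positivity
    set a : ℝ := ((n+1:ℕ):ℝ) with ha
    have hna : (n:ℝ) = a * (1 + (-(1/a))) := by field_simp; rw [ha]; push_cast; ring
    have ha1 : 1 ≤ a := by rw [ha]; push_cast; linarith [(Nat.cast_nonneg n : (0:ℝ) ≤ n)]
    have h1a : 1 / a ≤ 1 := by rw [div_le_one hn]; exact ha1
    have hb := rpow_one_add_le_one_add_mul_self (s := -(1/a)) (by linarith) hε.le hε1
    have h2 : (n:ℝ) ^ ε ≤ a ^ ε - ε * a ^ (ε - 1) := by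
      rw [hna, Real.mul_rpow hn.le (by linarith), Real.rpow_sub_one hn.ne']
      calc _ ≤ a ^ ε * (1 + ε * (-(1/a))) := mul_le_mul_of_nonneg_left hb (by positivity)
        _ = _ := by ring
    have h3 : (n:ℝ) ^ ε / ε ≤ (a ^ ε - ε * a ^ (ε - 1)) / ε := by gcongr
    have h4 : (a ^ ε - ε * a ^ (ε - 1)) / ε = a ^ ε / ε - a ^ (ε - 1) := by field_simp
    linarith

lemma pow_sub_bd {z w : ℂ} (hz : ‖z‖ ≤ 1) (hw : ‖w‖ ≤ 1) {h : ℝ} (hzw : ‖z - w‖ ≤ h) (n : ℕ) :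
    ‖z ^ n - w ^ n‖ ≤ n * h := by
  induction n with
  | zero => simp
  | succ n ih =>
    have : z ^ (n+1) - w ^ (n+1) = z ^ n * (z - w) + (z ^ n - w ^ n) * w := by ring
    rw [this]
    refine (norm_add_le _ _).trans ?_
    rw [norm_mul, norm_mul, norm_pow]
    have h1 : ‖z‖ ^ n * ‖z - w‖ ≤ 1 * h :=
      mul_le_mul (pow_le_one₀ (norm_nonneg _) hz) hzw (norm_nonneg _) zero_le_one
    have h2 : ‖z ^ n - w ^ n‖ * ‖w‖ ≤ n * h * 1 :=
      mul_le_mul ih hw (norm_nonneg _) ((norm_nonneg _).trans ih)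
    push_cast
    linarith

lemma tail_hasSum {Y : Type*} [MeasurableSpace Y] (μ : Measure Y) [IsProbabilityMeasure μ]
    (φ : Y → ℕ) (hφ : Measurable φ) (j : ℕ) :
    HasSum (fun n : ℕ => if j < n then (μ {y | φ y = n}).toReal else 0)
      (μ {y | j < φ y}).toReal := by
  have hU : {y | j < φ y} = ⋃ n : ℕ, {y | φ y = n ∧ j < n} := by
    ext y; simp
  have hm : ∀ n : ℕ, MeasurableSet {y | φ y = n ∧ j < n} := by
    intro n
    exact hφ (MeasurableSet.of_discrete (s := {k | k = n ∧ j < n}))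
  have hd : Pairwise (Function.onFun Disjoint fun n : ℕ => {y | φ y = n ∧ j < n}) := by
    intro a b hab
    refine Set.disjoint_left.2 fun y h1 h2 => hab (h1.1.symm.trans h2.1)
  have hs := measure_iUnion (μ := μ) hd hm
  rw [← hU] at hs
  have hne : ∑' n : ℕ, μ {y | φ y = n ∧ j < n} ≠ ⊤ := by
    rw [← hs]; exact measure_ne_top _ _
  have := ENNReal.hasSum_toReal hne
  rw [← ENNReal.tsum_toReal_eq (fun n => measure_ne_top _ _), ← hs] at this
  convert this using 2 with n
  by_cases h : j < n <;> simp [h]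

lemma Rz_basic
    {Y : Type*} [MeasurableSpace Y] (μ : Measure Y) [IsProbabilityMeasure μ]
    (φ : Y → ℕ) (hφmeas : Measurable φ)
    {B : Type*} [NormedAddCommGroup B] [NormedSpace ℂ B]
    (Rop : ℕ → B →L[ℂ] B) (hRop0 : Rop 0 = 0)
    (C : ℝ) (hC : 0 < C)
    (hH1 : ∀ n : ℕ, 1 ≤ n → ‖Rop n‖ ≤ C * (μ {y | φ y = n}).toReal)
    (Rz : ℂ → B →L[ℂ] B)
    (hRz : ∀ z : ℂ, ‖z‖ ≤ 1 → HasSum (fun n : ℕ => z ^ n • Rop n) (Rz z))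
    {z w : ℂ} (hz : ‖z‖ ≤ 1) (hw : ‖w‖ ≤ 1) {h : ℝ} (h0 : 0 < h) (h1 : h ≤ 1)
    (hzw : ‖z - w‖ ≤ h) :
    ‖Rz z - Rz w‖ ≤ 4 * C * h * ∑ j ∈ Finset.range ⌊1 / h⌋₊, (μ {y | j < φ y}).toReal := by
  set N := ⌊1 / h⌋₊ with hN
  have hx : 1 ≤ 1 / h := by rw [le_div_iff₀ h0]; linarith
  have hN1 : 1 ≤ N := Nat.le_floor (by simpa using hx)
  have hN2 : 1 / h < N + 1 := Nat.lt_floor_add_one _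
  have hN3 : 1 ≤ 2 * (N * h) := by
    rw [div_lt_iff₀ h0] at hN2
    have : (1:ℝ) ≤ N := by exact_mod_cast hN1
    nlinarith
  have hs := (hRz z hz).sub (hRz w hw)
  have hb := (hasSum_sum (s := Finset.range N) fun j _ => tail_hasSum μ φ hφmeas j).mul_left
    (4 * C * h)
  rw [← hs.tsum_eq]
  refine tsum_of_norm_bounded hb fun n => ?_
  rw [← sub_smul, norm_smul, ← Finset.sum_filter, Finset.sum_const, nsmul_eq_mul]
  rcases Nat.eq_zero_or_pos n with rfl | hn
  · simp [hRop0]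
  have hcard : (Finset.filter (fun j => j < n) (Finset.range N)).card = min n N := by
    have : Finset.filter (fun j => j < n) (Finset.range N) = Finset.range (min n N) := by
      ext j; simp; tauto
    rw [this, Finset.card_range]
  rw [hcard]
  have hp : 0 ≤ (μ {y | φ y = n}).toReal := ENNReal.toReal_nonneg
  have hmain : ‖z ^ n - w ^ n‖ ≤ 4 * h * ((min n N : ℕ) : ℝ) := by
    rcases le_total n N with hnN | hnN
    · rw [min_eq_left hnN]
      have := pow_sub_bd hz hw hzw n
      have : 0 ≤ (n:ℝ) * h := by positivity
      linarith
    · rw [min_eq_right hnN]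
      have h2 : ‖z ^ n - w ^ n‖ ≤ 1 + 1 := by
        refine (norm_sub_le _ _).trans (add_le_add ?_ ?_)
        · rw [norm_pow]; exact pow_le_one₀ (norm_nonneg _) hz
        · rw [norm_pow]; exact pow_le_one₀ (norm_nonneg _) hw
      linarith
  calc _ ≤ (4 * h * ((min n N : ℕ) : ℝ)) * (C * (μ {y | φ y = n}).toReal) :=
        mul_le_mul hmain (hH1 n hn) (norm_nonneg _) (by positivity)
    _ = _ := by ring

lemma tail_sum_bd
    {Y : Type*} [MeasurableSpace Y] (μ : Measure Y) [IsProbabilityMeasure μ]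
    (φ : Y → ℕ)
    (l : ℝ → ℝ) (hl : SlowlyVarying l) (β : ℝ) (hβ1 : 0 < β) (hβ2 : β ≤ 1)
    (htail : ∀ n : ℕ, 1 ≤ n → (μ {y | n < φ y}).toReal = l n * (n : ℝ) ^ (-β))
    (m : ℝ → ℝ)
    (hm : ∀ x : ℝ, m x = if β < 1 then l x else ∑ j ∈ Finset.Icc 1 ⌊x⌋₊, l j / j) :
    ∃ K : ℝ, 0 < K ∧ ∀ h : ℝ, 0 < h → h ≤ 1 →
      h * ∑ j ∈ Finset.range ⌊1 / h⌋₊, (μ {y | j < φ y}).toReal ≤ K * m (1 / h) * h ^ β := by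
  have hl1 : 0 < l 1 := sv_pos hl one_pos
  have hT : ∀ N : ℕ, ∑ j ∈ Finset.range N, (μ {y | j < φ y}).toReal ≤
      1 + ∑ j ∈ Finset.Icc 1 N, l j * (j:ℝ) ^ (-β) := by
    intro N
    have e : ∑ j ∈ Finset.Icc 1 N, l j * (j:ℝ) ^ (-β) =
        ∑ j ∈ Finset.Icc 1 N, (μ {y | j < φ y}).toReal :=
      Finset.sum_congr rfl fun j hj => (htail j (Finset.mem_Icc.1 hj).1).symm
    rw [e]
    have h01 : (μ {y | 0 < φ y}).toReal ≤ 1 := by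
      have := prob_le_one (μ := μ) (s := {y | 0 < φ y})
      exact ENNReal.toReal_le_of_le_ofReal zero_le_one (by simpa using this)
    have hsub : Finset.range N ⊆ insert 0 (Finset.Icc 1 N) := by
      intro j hj
      simp at hj ⊢
      omega
    calc _ ≤ ∑ j ∈ insert 0 (Finset.Icc 1 N), (μ {y | j < φ y}).toReal :=
          Finset.sum_le_sum_of_subset_of_nonneg hsub fun _ _ _ => ENNReal.toReal_nonneg
      _ = (μ {y | 0 < φ y}).toReal + ∑ j ∈ Finset.Icc 1 N, (μ {y | j < φ y}).toReal := by
          rw [Finset.sum_insert (by simp)]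
      _ ≤ _ := by gcongr
  rcases lt_or_eq_of_le hβ2 with hβ | hβ
  · obtain ⟨ε, hε⟩ : ∃ ε : ℝ, ε = (1 - β) / 2 := ⟨_, rfl⟩
    have hε0 : 0 < ε := by rw [hε]; linarith
    have hε1 : ε ≤ 1 := by rw [hε]; linarith
    obtain ⟨K, hK, hpot⟩ := sv_potter hl hε0
    refine ⟨K / l 1 + K / ε, by positivity, ?_⟩
    intro h h0 h1
    rw [hm, if_pos hβ]
    set x := 1 / h with hxdef
    have hx : 1 ≤ x := by rw [hxdef, le_div_iff₀ h0]; linarith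
    have hx0 : 0 < x := by linarith
    have hlx := sv_pos hl hx0
    set N := ⌊x⌋₊ with hN
    have hNx : (N:ℝ) ≤ x := Nat.floor_le hx0.le
    have hxx : x ^ ε ≤ x ^ ε * x ^ ε :=
      le_mul_of_one_le_left (by positivity) (Real.one_le_rpow hx hε0.le)
    have hone : 1 ≤ K / l 1 * (l x * (x ^ ε * x ^ ε)) := by
      have := hpot 1 x le_rfl hx
      rw [Real.one_rpow, mul_one] at this
      rw [div_mul_eq_mul_div, le_div_iff₀ hl1, one_mul]
      refine this.trans ?_
      gcongr
    have hsum : ∑ j ∈ Finset.Icc 1 N, l j * (j:ℝ) ^ (-β) ≤ K / ε * (l x * (x ^ ε * x ^ ε)) := by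
      calc _ ≤ ∑ j ∈ Finset.Icc 1 N, K * (l x * x ^ ε) * (j:ℝ) ^ (ε - 1) := by
            apply Finset.sum_le_sum
            intro j hj
            obtain ⟨hj1, hj2⟩ := Finset.mem_Icc.1 hj
            have hj1' : (1:ℝ) ≤ j := by exact_mod_cast hj1
            have hj2' : (j:ℝ) ≤ x := le_trans (by exact_mod_cast hj2) hNx
            have e : -β = ε + (ε - 1) := by rw [hε]; ring
            rw [e, Real.rpow_add (by linarith), ← mul_assoc]
            exact mul_le_mul_of_nonneg_right (hpot j x hj1' hj2') (by positivity)
        _ = K * (l x * x ^ ε) * ∑ j ∈ Finset.Icc 1 N, (j:ℝ) ^ (ε - 1) := by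
            rw [Finset.mul_sum]
        _ ≤ K * (l x * x ^ ε) * (x ^ ε / ε) := by
            gcongr
            refine (sum_rpow_bd hε0 hε1 N).trans ?_
            gcongr
        _ = _ := by ring
    have hh : h * (x ^ ε * x ^ ε) = h ^ β := by
      rw [← Real.rpow_add hx0, hxdef, one_div, Real.inv_rpow h0.le, ← Real.rpow_neg h0.le]
      nth_rewrite 1 [← Real.rpow_one h]
      rw [← Real.rpow_add h0]
      congr 1
      rw [hε]; ring
    calc _ ≤ h * (K / l 1 * (l x * (x ^ ε * x ^ ε)) + K / ε * (l x * (x ^ ε * x ^ ε))) := by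
          gcongr
          exact (hT N).trans (add_le_add hone hsum)
      _ = (K / l 1 + K / ε) * l x * (h * (x ^ ε * x ^ ε)) := by ring
      _ = _ := by rw [hh]
  · refine ⟨1 / l 1 + 1, by positivity, ?_⟩
    intro h h0 h1
    rw [hm, if_neg (by linarith), hβ, Real.rpow_one]
    have hx : 1 ≤ 1 / h := by rw [le_div_iff₀ h0]; linarith
    have hN1 : 1 ≤ ⌊1 / h⌋₊ := Nat.le_floor (by simpa using hx)
    set N := ⌊1 / h⌋₊ with hN
    have hT' := hT N
    have e : ∑ j ∈ Finset.Icc 1 N, l j * (j:ℝ) ^ (-β) = ∑ j ∈ Finset.Icc 1 N, l j / j := by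
      refine Finset.sum_congr rfl fun j hj => ?_
      rw [hβ, Real.rpow_neg_one, div_eq_mul_inv]
    rw [e] at hT'
    have hS : l 1 ≤ ∑ j ∈ Finset.Icc 1 N, l j / j := by
      have := Finset.single_le_sum (s := Finset.Icc 1 N) (f := fun j : ℕ => l j / j) (a := 1)
        (fun j hj => by
          have hj0 : (0:ℝ) < j := by exact_mod_cast (Finset.mem_Icc.1 hj).1
          exact (div_pos (sv_pos hl hj0) hj0).le) (Finset.mem_Icc.2 ⟨le_rfl, hN1⟩)
      simpa using this
    set S := ∑ j ∈ Finset.Icc 1 N, l j / j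
    have hone : 1 ≤ 1 / l 1 * S := by
      rw [div_mul_eq_mul_div, le_div_iff₀ hl1]; linarith
    calc _ ≤ h * (1 / l 1 * S + S) := by gcongr; linarith
      _ = _ := by ring

theorem Rz_Holder_continuity
    {Y : Type*} [MeasurableSpace Y] (μ : Measure Y) [IsProbabilityMeasure μ]
    (φ : Y → ℕ) (hφmeas : Measurable φ) (hφpos : ∀ y, 1 ≤ φ y)
    (l : ℝ → ℝ) (hl : SlowlyVarying l) (β : ℝ) (hβ1 : 0 < β) (hβ2 : β ≤ 1)
    (htail : ∀ n : ℕ, 1 ≤ n → (μ {y | n < φ y}).toReal = l n * (n : ℝ) ^ (-β))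
    {B : Type*} [NormedAddCommGroup B] [NormedSpace ℂ B] [CompleteSpace B]
    (Rop : ℕ → B →L[ℂ] B) (hRop0 : Rop 0 = 0)
    (C : ℝ) (hC : 0 < C)
    (hH1 : ∀ n : ℕ, 1 ≤ n → ‖Rop n‖ ≤ C * (μ {y | φ y = n}).toReal)
    (Rz : ℂ → B →L[ℂ] B)
    (hRz : ∀ z : ℂ, ‖z‖ ≤ 1 → HasSum (fun n : ℕ => z ^ n • Rop n) (Rz z))
    (m : ℝ → ℝ)
    (hm : ∀ x : ℝ, m x = if β < 1 then l x else ∑ j ∈ Finset.Icc 1 ⌊x⌋₊, l j / j) :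
    ∃ C' : ℝ, 0 < C' ∧
      (∀ θ : ℝ, 0 ≤ θ → θ < 2 * Real.pi → ∀ ρ : ℝ, 0 < ρ → ρ ≤ 1 →
        ∀ h : ℝ, 0 < h → h ≤ 1 →
        ‖Rz ((ρ : ℂ) * Complex.exp (Complex.I * (θ + h)))
            - Rz ((ρ : ℂ) * Complex.exp (Complex.I * θ))‖
          ≤ C' * m (1 / h) * h ^ β) ∧
      (∀ ρ : ℝ, 0 < ρ → ρ < 1 →
        ‖Rz (ρ : ℂ) - Rz 1‖ ≤ C' * m (1 / (1 - ρ)) * (1 - ρ) ^ β) := by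
  obtain ⟨K, hK, hbd⟩ := tail_sum_bd μ φ l hl β hβ1 hβ2 htail m hm
  have main : ∀ z w : ℂ, ‖z‖ ≤ 1 → ‖w‖ ≤ 1 → ∀ h : ℝ, 0 < h → h ≤ 1 → ‖z - w‖ ≤ h →
      ‖Rz z - Rz w‖ ≤ (4 * C * K) * m (1 / h) * h ^ β := by
    intro z w hz hw h h0 h1 hzw
    have h2 := Rz_basic μ φ hφmeas Rop hRop0 C hC hH1 Rz hRz hz hw h0 h1 hzw
    have h3 := mul_le_mul_of_nonneg_left (hbd h h0 h1) (by positivity : 0 ≤ 4 * C)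
    linarith
  refine ⟨4 * C * K, by positivity, ?_, ?_⟩
  · intro θ _ _ ρ hρ0 hρ1 h h0 h1
    have hexp : ∀ t : ℝ, ‖Complex.exp (Complex.I * t)‖ = 1 := by
      intro t; rw [mul_comm]; exact Complex.norm_exp_ofReal_mul_I t
    have hρn : ‖(ρ:ℂ)‖ = ρ := by rw [Complex.norm_real, Real.norm_of_nonneg hρ0.le]
    refine main _ _ ?_ ?_ h h0 h1 ?_
    · rw [norm_mul, hρn, ← Complex.ofReal_add, hexp]; linarith
    · rw [norm_mul, hρn, hexp]; linarith
    · have e : (ρ:ℂ) * Complex.exp (Complex.I * (θ + h)) - ρ * Complex.exp (Complex.I * θ)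
          = ρ * Complex.exp (Complex.I * θ) * (Complex.exp (Complex.I * h) - 1) := by
        rw [mul_add, Complex.exp_add]; ring
      rw [e, norm_mul, norm_mul, hρn, hexp]
      have := Real.norm_exp_I_mul_ofReal_sub_one_le (x := h)
      rw [Real.norm_of_nonneg h0.le] at this
      have := norm_nonneg (Complex.exp (Complex.I * h) - 1)
      nlinarith
  · intro ρ h0 h1
    refine main _ _ ?_ (by simp) (1 - ρ) (by linarith) (by linarith) ?_
    · rw [Complex.norm_real, Real.norm_of_nonneg h0.le]; exact h1.le
    · rw [← Complex.ofReal_one, ← Complex.ofReal_sub, Complex.norm_real, Real.norm_eq_abs,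
        abs_sub_comm, abs_of_nonneg (by linarith)]
end

section
/- Eigenvalue expansion with error term: let (Y,μ) be a probability space and φ : Y → {1,2,3,…} measurable with μ(φ > n) = c(n^{−β} + H(n)) for all n ≥ 1, where β ∈ (0,1), c > 0, and H(n) = O(n^{−q}) for some q > 1. Let G(x) = μ(φ ≤ x), H₁(x) = (1 − G(x))/c − x^{−β} for x > 0 (so H₁ is absolutely integrable on (0,∞)), and c_H = ∫_0^∞ H₁(x) dx. Suppose that for θ ∈ (0,ε) there are functions v_θ ∈ L^∞(Y, ℂ) with ∫_Y v_θ dμ = 1 and ‖v_θ − 1‖_∞ ≤ K θ^β for a constant K, and define λ(θ) = ∫_Y e^{iθφ} v_θ dμ. Then λ(θ) = 1 − c·c_β·θ^β + i·c·c_H·θ + O(θ^{2β}) + O(θ^{q}) as θ → 0⁺, where c_β = −i·lim_{M→∞} ∫_0^M e^{iσ} σ^{−β} dσ. -/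
open MeasureTheory Filter Topology

theorem aux_fubini {Y : Type*} [MeasurableSpace Y] (μ : Measure Y) [IsProbabilityMeasure μ]
    {E : Type*} [NormedAddCommGroup E] [NormedSpace ℝ E] [CompleteSpace E]
    (φ : Y → ℕ) (hφmeas : Measurable φ) (g : ℝ → E) (hg : Continuous g) (T : ℝ) (hT : 0 ≤ T) :
    ∫ y, (∫ x in (0:ℝ)..(min (φ y : ℝ) T), g x) ∂μ
      = ∫ x in (0:ℝ)..T, (μ {y | x < (φ y : ℝ)}).toReal • g x := by
  have hφ' : Measurable (fun y => (φ y : ℝ)) := measurable_from_top.comp hφmeas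
  set A : Set (Y × ℝ) := {p | p.2 < (φ p.1 : ℝ)} with hA
  have hAm : MeasurableSet A := measurableSet_lt measurable_snd (hφ'.comp measurable_fst)
  set F : Y → ℝ → E := fun y x => A.indicator (fun p => g p.2) (y, x) with hF
  have h1 : ∀ y, (∫ x in (0:ℝ)..(min (φ y : ℝ) T), g x) = ∫ x in Set.Ioc 0 T, F y x := by
    intro y
    have h0 : (0:ℝ) ≤ min (φ y : ℝ) T := le_min (Nat.cast_nonneg _) hT
    rw [intervalIntegral.integral_of_le h0, integral_Ioc_eq_integral_Ioo]
    have : ∀ x, F y x = (Set.Iio (φ y : ℝ)).indicator g x := by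
      intro x; simp [hF, hA, Set.indicator_apply]
    simp_rw [this]
    rw [setIntegral_indicator measurableSet_Iio]
    rcases le_total (φ y : ℝ) T with h | h
    · rw [min_eq_left h]
      congr 2
      ext x; constructor
      · rintro ⟨a, b⟩; exact ⟨⟨a, by linarith⟩, b⟩
      · rintro ⟨⟨a, _⟩, b⟩; exact ⟨a, b⟩
    · rw [min_eq_right h, ← integral_Ioc_eq_integral_Ioo]
      apply setIntegral_congr_set
      have e : (Set.Ioc 0 T ∩ Set.Iio (φ y : ℝ) : Set ℝ) =ᵐ[volume] (Set.Ioc 0 T ∩ Set.Iic (φ y : ℝ) : Set ℝ) :=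
        (ae_eq_refl _).inter Iio_ae_eq_Iic
      refine EventuallyEq.trans (Eq.eventuallyEq ?_) e.symm
      symm
      apply Set.inter_eq_left.2
      intro x hx
      exact hx.2.trans h
  simp_rw [h1]
  have hint : Integrable (Function.uncurry F) (μ.prod (volume.restrict (Set.Ioc 0 T))) := by
    obtain ⟨C, hC⟩ := (isCompact_Icc (a := (0:ℝ)) (b := T)).exists_bound_of_continuousOn hg.continuousOn
    have hm : StronglyMeasurable (Function.uncurry F) := by
      have : Function.uncurry F = A.indicator (fun p => g p.2) := by ext ⟨a, b⟩; rfl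
      rw [this]
      exact (hg.stronglyMeasurable.comp_measurable measurable_snd).indicator hAm
    refine Integrable.of_bound hm.aestronglyMeasurable C ?_
    have : ∀ᵐ p ∂(μ.prod (volume.restrict (Set.Ioc 0 T))), p.2 ∈ Set.Ioc 0 T :=
      Measure.quasiMeasurePreserving_snd.ae (ae_restrict_mem measurableSet_Ioc)
    filter_upwards [this] with p hp
    have hb := hC p.2 ⟨hp.1.le, hp.2⟩
    have : Function.uncurry F p = A.indicator (fun p => g p.2) p := rfl
    rw [this]
    exact (norm_indicator_le_norm_self _ _).trans hb
  rw [integral_integral_swap hint, intervalIntegral.integral_of_le hT]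
  congr 1
  ext x
  have : ∀ y, F y x = {y | x < (φ y : ℝ)}.indicator (fun _ => g x) y := by
    intro y; simp [hF, hA, Set.indicator_apply]
  simp_rw [this]
  rw [integral_indicator (measurableSet_lt measurable_const hφ')]
  simp [Measure.real]

theorem aux_osc (r : ℝ) (h1 : 1 < r) (h2 : r < 2) :
    IntegrableOn (fun u : ℝ => ‖Complex.exp (Complex.I * u) - 1‖ * u ^ (-r)) (Set.Ioi 0) := by
  have hm : Measurable (fun u : ℝ => ‖Complex.exp (Complex.I * u) - 1‖ * u ^ (-r)) := by fun_prop
  rw [← Set.Ioc_union_Ioi_eq_Ioi (zero_le_one' ℝ)]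
  refine IntegrableOn.union ?_ ?_
  · have : IntegrableOn (fun u : ℝ => u ^ (1 - r)) (Set.Ioc 0 1) := by
      rw [← intervalIntegrable_iff_integrableOn_Ioc_of_le zero_le_one]
      exact intervalIntegral.intervalIntegrable_rpow' (by linarith)
    refine this.mono' hm.aestronglyMeasurable ?_
    filter_upwards [ae_restrict_mem measurableSet_Ioc] with u hu
    have hu0 : 0 < u := hu.1
    have e := Real.norm_exp_I_mul_ofReal_sub_one_le (x := u)
    rw [Real.norm_eq_abs, abs_of_nonneg (by positivity), show 1 - r = 1 + -r by ring, Real.rpow_add hu0, Real.rpow_one]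
    gcongr
    rwa [Real.norm_eq_abs, abs_of_pos hu0] at e
  · have : IntegrableOn (fun u : ℝ => 2 * u ^ (-r)) (Set.Ioi 1) :=
      (integrableOn_Ioi_rpow_of_lt (by linarith) zero_lt_one).const_mul 2
    refine this.mono' hm.aestronglyMeasurable ?_
    filter_upwards [ae_restrict_mem measurableSet_Ioi] with u hu
    have hu0 : 0 < u := lt_trans zero_lt_one hu
    rw [Real.norm_eq_abs, abs_of_nonneg (by positivity)]
    gcongr
    refine (norm_sub_le _ _).trans ?_
    rw [mul_comm, Complex.norm_exp_ofReal_mul_I]; norm_num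

theorem aux_H (β : ℝ) (hβ1 : 0 < β) (hβ2 : β < 1) (q r : ℝ) (hr1 : r ≤ q) (hr2 : r ≤ 1 + β)
    (hr : 0 < r) (K : ℝ) (x h : ℝ) (hx : 1 ≤ x) (hh : |h| ≤ K * (⌊x⌋₊ : ℝ) ^ (-q)) :
    |(⌊x⌋₊ : ℝ) ^ (-β) + h - x ^ (-β)| ≤ (1 + |K|) * 2 ^ r * x ^ (-r) := by
  have hx0 : 0 < x := by linarith
  set n : ℝ := (⌊x⌋₊ : ℝ) with hn
  have hn1 : 1 ≤ n := by
    have := (Nat.one_le_floor_iff x).2 hx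
    rw [hn]; exact_mod_cast this
  have hn0 : 0 < n := by linarith
  have hnx : n ≤ x := Nat.floor_le hx0.le
  have hxn : x < n + 1 := Nat.lt_floor_add_one x
  have hnr : n ^ (-r) ≤ 2 ^ r * x ^ (-r) := by
    have : n ^ (-r) ≤ (x / 2) ^ (-r) :=
      Real.rpow_le_rpow_of_nonpos (by positivity) (by linarith) (by linarith)
    refine this.trans (le_of_eq ?_)
    rw [Real.div_rpow hx0.le zero_le_two, Real.rpow_neg zero_le_two, div_inv_eq_mul, mul_comm]
  have a1 : |h| ≤ |K| * n ^ (-r) := by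
    refine hh.trans ?_
    refine (mul_le_mul_of_nonneg_right (le_abs_self K) (by positivity)).trans ?_
    gcongr
  have a2 : |n ^ (-β) - x ^ (-β)| ≤ n ^ (-r) := by
    have b1 : x ^ (-β) ≤ n ^ (-β) := Real.rpow_le_rpow_of_nonpos hn0 hnx (by linarith)
    rw [abs_of_nonneg (by linarith)]
    have b2 : n / x ≤ (n / x) ^ β := by
      have := Real.rpow_le_rpow_of_exponent_ge (x := n / x) (by positivity) ((div_le_one hx0).2 hnx) hβ2.le
      rwa [Real.rpow_one] at this
    have b3 : x ^ (-β) = n ^ (-β) * (n / x) ^ β := by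
      rw [Real.div_rpow hn0.le hx0.le, Real.rpow_neg hx0.le, Real.rpow_neg hn0.le]
      have := (Real.rpow_pos_of_pos hn0 β).ne'
      field_simp
    have b4 : 1 - n / x ≤ n⁻¹ := by
      have : 1 - n / x = (x - n) / x := by field_simp
      rw [this, inv_eq_one_div]
      gcongr
      linarith
    have b5 : n ^ (-β) - x ^ (-β) ≤ n ^ (-β) * n⁻¹ := by
      rw [b3, ← mul_one_sub]
      gcongr
      linarith
    have b6 : n ^ (-β) * n⁻¹ = n ^ (-(1 + β)) := by
      rw [← Real.rpow_neg_one n, ← Real.rpow_add hn0]; congr 1; ring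
    rw [b6] at b5
    refine b5.trans ?_
    gcongr
  calc |n ^ (-β) + h - x ^ (-β)| = |(n ^ (-β) - x ^ (-β)) + h| := by congr 1; ring
    _ ≤ _ := abs_add_le _ _
    _ ≤ n ^ (-r) + |K| * n ^ (-r) := add_le_add a2 a1
    _ = (1 + |K|) * n ^ (-r) := by ring
    _ ≤ (1 + |K|) * (2 ^ r * x ^ (-r)) := by gcongr
    _ = _ := by ring

theorem aux_small {Y : Type*} [MeasurableSpace Y] (μ : Measure Y) [IsProbabilityMeasure μ]
    (φ : Y → ℕ) (hφmeas : Measurable φ) (β : ℝ) (hβ1 : 0 < β) (hβ2 : β < 1) (C : ℝ)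
    (hS : ∀ x : ℝ, 0 < x → (μ {y | x < (φ y : ℝ)}).toReal ≤ C * x ^ (-β)) (θ : ℝ) (hθ : 0 < θ) :
    ∫ y, ‖Complex.exp (Complex.I * θ * (φ y : ℝ)) - 1‖ ∂μ ≤ C * (2 ^ (1 - β) / (1 - β)) * θ ^ β := by
  have hφ' : Measurable (fun y => (φ y : ℝ)) := measurable_from_top.comp hφmeas
  have hT : 0 ≤ 2 / θ := by positivity
  have key := aux_fubini μ φ hφmeas (fun _ => (1:ℝ)) continuous_const (2 / θ) hT
  simp only [intervalIntegral.integral_const, smul_eq_mul, mul_one, sub_zero] at key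
  have hpt : ∀ y, ‖Complex.exp (Complex.I * θ * (φ y : ℝ)) - 1‖ ≤ θ * min (φ y : ℝ) (2 / θ) := by
    intro y
    have e : Complex.I * θ * (φ y : ℝ) = Complex.I * ((θ * φ y : ℝ) : ℂ) := by push_cast; ring
    rw [e, mul_min_of_nonneg _ _ hθ.le]
    refine le_min ?_ ?_
    · refine Real.norm_exp_I_mul_ofReal_sub_one_le.trans (le_of_eq ?_)
      rw [Real.norm_eq_abs, abs_of_nonneg (by positivity)]
    · refine (norm_sub_le _ _).trans ?_
      rw [mul_comm Complex.I, Complex.norm_exp_ofReal_mul_I, mul_div_cancel₀ _ hθ.ne']; norm_num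
  have hint2 : Integrable (fun y => θ * min (φ y : ℝ) (2 / θ)) μ := by
    refine Integrable.of_bound (by fun_prop) 2 (ae_of_all _ fun y => ?_)
    rw [Real.norm_eq_abs, abs_of_nonneg (by positivity), mul_min_of_nonneg _ _ hθ.le, mul_div_cancel₀ _ hθ.ne']
    exact min_le_right _ _
  have hint1 : Integrable (fun y => ‖Complex.exp (Complex.I * θ * (φ y : ℝ)) - 1‖) μ := by
    refine hint2.mono' (by fun_prop) (ae_of_all _ fun y => ?_)
    simpa using hpt y
  have hSm : Antitone (fun x : ℝ => (μ {y | x < (φ y : ℝ)}).toReal) := by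
    intro a b hab
    exact ENNReal.toReal_mono (measure_ne_top _ _) (measure_mono fun y hy => lt_of_le_of_lt hab hy)
  have hle : ∫ x in (0:ℝ)..(2 / θ), (μ {y | x < (φ y : ℝ)}).toReal ≤ ∫ x in (0:ℝ)..(2 / θ), C * x ^ (-β) := by
    refine intervalIntegral.integral_mono_on_of_le_Ioo hT hSm.intervalIntegrable
      ((intervalIntegral.intervalIntegrable_rpow' (by linarith)).const_mul C) ?_
    intro x hx
    exact hS x hx.1
  rw [intervalIntegral.integral_const_mul, integral_rpow (Or.inl (by linarith)), Real.zero_rpow (by linarith)] at hle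
  calc _ ≤ ∫ y, θ * min (φ y : ℝ) (2 / θ) ∂μ := integral_mono hint1 hint2 hpt
    _ = θ * ∫ y, min (φ y : ℝ) (2 / θ) ∂μ := integral_const_mul _ _
    _ ≤ θ * (C * (((2 / θ) ^ (-β + 1) - 0) / (-β + 1))) := by rw [key]; gcongr
    _ = _ := by
      have e1 : (2 / θ) ^ (-β + 1) = 2 ^ (1 - β) * θ ^ β / θ := by
        rw [show -β + 1 = 1 - β by ring, Real.div_rpow zero_le_two hθ.le, Real.rpow_sub hθ, Real.rpow_one]
        field_simp
      have : 1 - β ≠ 0 := by linarith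
      rw [e1, show -β + 1 = 1 - β by ring]
      field_simp
      ring

theorem aux_main {Y : Type*} [MeasurableSpace Y] (μ : Measure Y) [IsProbabilityMeasure μ]
    (φ : Y → ℕ) (hφmeas : Measurable φ)
    (β : ℝ) (hβ1 : 0 < β) (hβ2 : β < 1) (c : ℝ) (H₁ : ℝ → ℝ)
    (hS : ∀ x : ℝ, 0 < x → (μ {y | x < (φ y : ℝ)}).toReal = c * (x ^ (-β) + H₁ x))
    (hH₁int : IntegrableOn H₁ (Set.Ioi 0))
    (cβ : ℂ)
    (hcβ : Tendsto (fun M : ℝ =>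
        ∫ σ in (0 : ℝ)..M, Complex.exp (Complex.I * σ) * ((σ ^ (-β) : ℝ) : ℂ))
      atTop (𝓝 (Complex.I * cβ))) (θ : ℝ) (hθ : 0 < θ) :
    ∫ y, (Complex.exp (Complex.I * θ * (φ y : ℝ))) ∂μ = 1 - c * cβ * ((θ ^ β : ℝ) : ℂ)
      + Complex.I * θ * c * ∫ x in Set.Ioi (0:ℝ), Complex.exp (Complex.I * θ * x) * (H₁ x : ℂ) := by
  have hφ' : Measurable (fun y => (φ y : ℝ)) := measurable_from_top.comp hφmeas
  have hθc : (Complex.I * θ : ℂ) ≠ 0 := by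
    simp [hθ.ne']
  have hn1 : ∀ x : ℝ, ‖Complex.exp (Complex.I * θ * x)‖ = 1 := by
    intro x
    rw [show Complex.I * θ * x = ((θ * x : ℝ) : ℂ) * Complex.I by push_cast; ring, Complex.norm_exp_ofReal_mul_I]
  have hgc : Continuous (fun x : ℝ => Complex.exp (Complex.I * θ * x)) := by fun_prop
  -- left limit
  have L : Tendsto (fun T : ℝ => ∫ y, (∫ x in (0:ℝ)..(min (φ y : ℝ) T), Complex.exp (Complex.I * θ * x)) ∂μ)
      atTop (𝓝 (∫ y, (Complex.exp (Complex.I * θ * (φ y : ℝ)) - 1) / (Complex.I * θ) ∂μ)) := by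
    simp_rw [integral_exp_mul_complex hθc]
    refine tendsto_integral_filter_of_dominated_convergence (fun _ => 2 / ‖(Complex.I * θ : ℂ)‖) ?_ ?_ ?_ ?_
    · refine Eventually.of_forall fun T => ?_
      refine Measurable.aestronglyMeasurable ?_
      fun_prop
    · refine Eventually.of_forall fun T => ae_of_all _ fun y => ?_
      rw [norm_div]
      gcongr
      refine (norm_sub_le _ _).trans ?_
      rw [hn1, hn1]; norm_num
    · exact integrable_const _
    · refine ae_of_all _ fun y => ?_
      refine tendsto_const_nhds.congr' ?_
      filter_upwards [eventually_ge_atTop (φ y : ℝ)] with T hT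
      rw [min_eq_left hT]; simp
  -- right limit
  have R1 : Tendsto (fun T : ℝ => ∫ x in (0:ℝ)..T, Complex.exp (Complex.I * θ * x) * ((x ^ (-β) : ℝ) : ℂ))
      atTop (𝓝 (((θ ^ (β - 1) : ℝ) : ℂ) * (Complex.I * cβ))) := by
    have := (hcβ.comp (tendsto_id.const_mul_atTop hθ)).const_mul ((θ ^ (β - 1) : ℝ) : ℂ)
    refine this.congr' ?_
    filter_upwards [eventually_ge_atTop (0:ℝ)] with T hT
    simp only [Function.comp, id]
    have hsub := intervalIntegral.integral_comp_mul_left (a := 0) (b := T)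
      (fun σ : ℝ => Complex.exp (Complex.I * σ) * ((σ ^ (-β) : ℝ) : ℂ)) hθ.ne'
    rw [mul_zero] at hsub
    have h2 : ∫ σ in (0:ℝ)..(θ * T), Complex.exp (Complex.I * σ) * ((σ ^ (-β) : ℝ) : ℂ)
        = (θ : ℂ) * ∫ x in (0:ℝ)..T, Complex.exp (Complex.I * (θ * x : ℝ)) * (((θ * x) ^ (-β) : ℝ) : ℂ) := by
      rw [hsub, Complex.real_smul]
      have : (θ : ℂ) ≠ 0 := by exact_mod_cast hθ.ne'
      push_cast
      field_simp
    rw [h2, ← intervalIntegral.integral_const_mul, ← intervalIntegral.integral_const_mul]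
    refine intervalIntegral.integral_congr fun x hx => ?_
    rw [Set.uIcc_of_le hT] at hx
    have e : θ ^ (β - 1) * (θ * θ ^ (-β)) = 1 := by
      rw [Real.rpow_sub_one hθ.ne', Real.rpow_neg hθ.le]
      have := (Real.rpow_pos_of_pos hθ β).ne'
      field_simp
    have ec : ((θ ^ (β - 1) : ℝ) : ℂ) * ((θ : ℂ) * ((θ ^ (-β) : ℝ) : ℂ)) = 1 := by exact_mod_cast e
    rw [Real.mul_rpow hθ.le hx.1, Complex.ofReal_mul, Complex.ofReal_mul, ← mul_assoc Complex.I]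
    linear_combination (Complex.exp (Complex.I * θ * x) * ((x ^ (-β) : ℝ) : ℂ)) * ec
  have hHi : IntegrableOn (fun x : ℝ => Complex.exp (Complex.I * θ * x) * (H₁ x : ℂ)) (Set.Ioi 0) := by
    refine Integrable.bdd_mul (c := 1) hH₁int.ofReal hgc.aestronglyMeasurable (ae_of_all _ fun x => (hn1 x).le)
  have R2 := intervalIntegral_tendsto_integral_Ioi 0 hHi tendsto_id
  have R : Tendsto (fun T : ℝ => ∫ x in (0:ℝ)..T, (μ {y | x < (φ y : ℝ)}).toReal • Complex.exp (Complex.I * θ * x))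
      atTop (𝓝 ((c : ℂ) * (((θ ^ (β - 1) : ℝ) : ℂ) * (Complex.I * cβ)
        + ∫ x in Set.Ioi (0:ℝ), Complex.exp (Complex.I * θ * x) * (H₁ x : ℂ)))) := by
    refine ((R1.add R2).const_mul (c : ℂ)).congr' ?_
    filter_upwards [eventually_ge_atTop (0:ℝ)] with T hT
    simp only [id]
    rw [← intervalIntegral.integral_add, ← intervalIntegral.integral_const_mul]
    · rw [intervalIntegral.integral_of_le hT, intervalIntegral.integral_of_le hT]
      refine setIntegral_congr_fun measurableSet_Ioc fun x hx => ?_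
      rw [hS x hx.1, Complex.real_smul]
      push_cast
      ring
    · refine IntervalIntegrable.continuousOn_mul ?_ hgc.continuousOn
      have hi : IntervalIntegrable (fun x : ℝ => x ^ (-β)) volume 0 T :=
        intervalIntegral.intervalIntegrable_rpow' (by linarith)
      rw [intervalIntegrable_iff] at hi ⊢
      exact Integrable.ofReal hi
    · rw [intervalIntegrable_iff_integrableOn_Ioc_of_le hT]
      exact hHi.mono_set Set.Ioc_subset_Ioi_self
  have LR := tendsto_nhds_unique (L.congr' (by
    filter_upwards [eventually_ge_atTop (0:ℝ)] with T hT
    exact aux_fubini μ φ hφmeas _ hgc T hT)) R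
  have hei : Integrable (fun y => Complex.exp (Complex.I * θ * (φ y : ℝ))) μ :=
    Integrable.of_bound (by fun_prop) 1 (ae_of_all _ fun y => (hn1 _).le)
  rw [integral_div, integral_sub hei (integrable_const _), div_eq_iff hθc] at LR
  simp only [integral_const, probReal_univ, one_smul] at LR
  have e : θ ^ (β - 1) * θ = θ ^ β := by
    rw [Real.rpow_sub_one hθ.ne']; field_simp
  have ec : ((θ ^ (β - 1) : ℝ) : ℂ) * (θ : ℂ) = ((θ ^ β : ℝ) : ℂ) := by exact_mod_cast e
  rw [← ec]
  linear_combination LR + (c : ℂ) * ((θ ^ (β - 1) : ℝ) : ℂ) * (θ : ℂ) * cβ * Complex.I_mul_I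

theorem eigenvalue_expansion_with_error
    {Y : Type*} [MeasurableSpace Y] (μ : Measure Y) [IsProbabilityMeasure μ]
    (φ : Y → ℕ) (hφmeas : Measurable φ) (hφpos : ∀ y, 1 ≤ φ y)
    (β : ℝ) (hβ1 : 0 < β) (hβ2 : β < 1)
    (c : ℝ) (hc : 0 < c) (q : ℝ) (hq : 1 < q) (H : ℕ → ℝ)
    (hH : ∃ K : ℝ, ∀ n : ℕ, 1 ≤ n → |H n| ≤ K * (n : ℝ) ^ (-q))
    (htail : ∀ n : ℕ, 1 ≤ n →
      (μ {y | n < φ y}).toReal = c * ((n : ℝ) ^ (-β) + H n))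
    (H₁ : ℝ → ℝ)
    (hH₁def : ∀ x : ℝ, 0 < x →
      H₁ x = (1 - (μ {y | (φ y : ℝ) ≤ x}).toReal) / c - x ^ (-β))
    (hH₁int : IntegrableOn H₁ (Set.Ioi 0))
    (cβ : ℂ)
    (hcβ : Tendsto (fun M : ℝ =>
        ∫ σ in (0 : ℝ)..M, Complex.exp (Complex.I * σ) * ((σ ^ (-β) : ℝ) : ℂ))
      atTop (𝓝 (Complex.I * cβ)))
    (ε : ℝ) (hε : 0 < ε) (K : ℝ)
    (vθ : ℝ → Y → ℂ)
    (hv_meas : ∀ θ : ℝ, 0 < θ → θ < ε → Measurable (vθ θ))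
    (hv_int : ∀ θ : ℝ, 0 < θ → θ < ε → (∫ y, vθ θ y ∂μ) = 1)
    (hv_bd : ∀ θ : ℝ, 0 < θ → θ < ε → ∀ᵐ y ∂μ, ‖vθ θ y - 1‖ ≤ K * θ ^ β)
    (lam : ℝ → ℂ)
    (hlam : ∀ θ : ℝ, 0 < θ → θ < ε →
      lam θ = ∫ y, Complex.exp (Complex.I * θ * (φ y : ℝ)) * vθ θ y ∂μ) :
    ∃ K' ε' : ℝ, 0 < K' ∧ 0 < ε' ∧ ∀ θ : ℝ, 0 < θ → θ < ε' →
      ‖lam θ - (1 - (c : ℂ) * cβ * ((θ ^ β : ℝ) : ℂ)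
          + Complex.I * c * ((∫ x in Set.Ioi (0 : ℝ), H₁ x : ℝ) : ℂ) * (θ : ℂ))‖
        ≤ K' * (θ ^ (2 * β) + θ ^ q) := by
  obtain ⟨K0, hK0⟩ := hH
  have hφ' : Measurable (fun y => (φ y : ℝ)) := measurable_from_top.comp hφmeas
  set r := min q (1 + β) with hr
  have hr1 : r ≤ q := min_le_left _ _
  have hr2 : r ≤ 1 + β := min_le_right _ _
  have hr3 : 1 < r := lt_min hq (by linarith)
  have hr4 : r < 2 := by linarith
  have hcompl : ∀ x : ℝ, (μ {y | x < (φ y : ℝ)}).toReal = 1 - (μ {y | (φ y : ℝ) ≤ x}).toReal := by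
    intro x
    have := probReal_compl_eq_one_sub (μ := μ) (s := {y | (φ y : ℝ) ≤ x}) (measurableSet_le hφ' measurable_const)
    have e : {y | (φ y : ℝ) ≤ x}ᶜ = {y | x < (φ y : ℝ)} := by ext; simp
    rw [e] at this
    exact this
  have hS : ∀ x : ℝ, 0 < x → (μ {y | x < (φ y : ℝ)}).toReal = c * (x ^ (-β) + H₁ x) := by
    intro x hx
    rw [hcompl, hH₁def x hx]
    field_simp
    ring
  have hfl : ∀ x : ℝ, 1 ≤ x → H₁ x = (⌊x⌋₊ : ℝ) ^ (-β) + H ⌊x⌋₊ - x ^ (-β) := by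
    intro x hx
    have hx0 : 0 < x := by linarith
    have h1 := hS x hx0
    have e : {y | x < (φ y : ℝ)} = {y | ⌊x⌋₊ < φ y} := by
      ext y; exact (Nat.floor_lt hx0.le).symm
    rw [e, htail _ ((Nat.one_le_floor_iff x).2 hx)] at h1
    have := mul_left_cancel₀ hc.ne' h1
    linarith
  obtain ⟨C, hC0, hC⟩ : ∃ C : ℝ, 0 ≤ C ∧ ∀ x : ℝ, 0 < x → |H₁ x| ≤ C * x ^ (-r) := by
    refine ⟨max (1 / c + 1) ((1 + |K0|) * 2 ^ r), by positivity, fun x hx => ?_⟩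
    rcases lt_or_ge x 1 with h | h
    · have e : {y | (φ y : ℝ) ≤ x} = ∅ := by
        ext y
        simp only [Set.mem_ofPred_eq, Set.mem_empty_iff_false, iff_false, not_le]
        have : (1 : ℝ) ≤ φ y := by exact_mod_cast hφpos y
        linarith
      rw [hH₁def x hx, e]
      simp only [measure_empty, ENNReal.toReal_zero, sub_zero]
      have i1 : 1 ≤ x ^ (-r) := Real.one_le_rpow_of_pos_of_le_one_of_nonpos hx h.le (by linarith)
      have i2 : x ^ (-β) ≤ x ^ (-r) := Real.rpow_le_rpow_of_exponent_ge hx h.le (by linarith)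
      have i3 : 0 < x ^ (-β) := Real.rpow_pos_of_pos hx _
      have i4 : 0 < 1 / c := by positivity
      calc |1 / c - x ^ (-β)| ≤ |1 / c| + |x ^ (-β)| := abs_sub _ _
        _ = 1 / c * 1 + x ^ (-β) := by rw [abs_of_pos i3, abs_of_pos i4, mul_one]
        _ ≤ 1 / c * x ^ (-r) + x ^ (-r) := by gcongr
        _ = (1 / c + 1) * x ^ (-r) := by ring
        _ ≤ _ := by gcongr; exact le_max_left _ _
    · rw [hfl x h]
      refine (aux_H β hβ1 hβ2 q r hr1 hr2 (by linarith) K0 x _ h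
        (hK0 _ ((Nat.one_le_floor_iff x).2 h))).trans ?_
      gcongr
      exact le_max_right _ _
  have hS2 : ∀ x : ℝ, 0 < x → (μ {y | x < (φ y : ℝ)}).toReal ≤ (1 + c * (1 + C)) * x ^ (-β) := by
    intro x hx
    have i3 : 0 < x ^ (-β) := Real.rpow_pos_of_pos hx _
    rcases lt_or_ge x 1 with h | h
    · have i1 : 1 ≤ x ^ (-β) := Real.one_le_rpow_of_pos_of_le_one_of_nonpos hx h.le (by linarith)
      have i2 : (μ {y | x < (φ y : ℝ)}).toReal ≤ 1 := measureReal_le_one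
      have i4 : 0 ≤ c * (1 + C) * x ^ (-β) := by positivity
      linarith
    · rw [hS x hx]
      have i2 : x ^ (-r) ≤ x ^ (-β) := Real.rpow_le_rpow_of_exponent_le h (by linarith)
      have i4 : H₁ x ≤ C * x ^ (-β) := (le_abs_self _).trans ((hC x hx).trans (by gcongr))
      have : c * (x ^ (-β) + H₁ x) ≤ c * (x ^ (-β) + C * x ^ (-β)) := by gcongr
      linarith
  set D := ∫ u in Set.Ioi (0:ℝ), ‖Complex.exp (Complex.I * u) - 1‖ * u ^ (-r) with hD
  have hDint := aux_osc r hr3 hr4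
  have hD0 : 0 ≤ D := setIntegral_nonneg measurableSet_Ioi fun u hu => by
    have : 0 < u := hu
    positivity
  set B := (1 + c * (1 + C)) * (2 ^ (1 - β) / (1 - β)) with hB
  have hB0 : 0 ≤ B := by
    have : 0 < 1 - β := by linarith
    positivity
  refine ⟨|K| * B + c * C * D + 1, min ε 1, by positivity, lt_min hε one_pos, fun θ hθ hθε => ?_⟩
  have hθ1 : θ < ε := lt_of_lt_of_le hθε (min_le_left _ _)
  have hθ2 : θ < 1 := lt_of_lt_of_le hθε (min_le_right _ _)
  have hn1 : ∀ x : ℝ, ‖Complex.exp (Complex.I * θ * x)‖ = 1 := by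
    intro x
    rw [show Complex.I * θ * x = ((θ * x : ℝ) : ℂ) * Complex.I by push_cast; ring, Complex.norm_exp_ofReal_mul_I]
  have hgc : Continuous (fun x : ℝ => Complex.exp (Complex.I * θ * x)) := by fun_prop
  have hgm : Measurable (fun y => Complex.exp (Complex.I * θ * (φ y : ℝ))) := hgc.measurable.comp hφ'
  have hvm := hv_meas θ hθ hθ1
  have hbd := hv_bd θ hθ hθ1
  have hei : Integrable (fun y => Complex.exp (Complex.I * θ * (φ y : ℝ))) μ :=
    Integrable.of_bound hgm.aestronglyMeasurable 1 (ae_of_all _ fun y => (hn1 _).le)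
  have hv1 : Integrable (fun y => vθ θ y - 1) μ :=
    Integrable.of_bound (hvm.sub_const 1).aestronglyMeasurable _ hbd
  have hv : Integrable (vθ θ) μ := by
    have := hv1.add (integrable_const (1:ℂ))
    refine this.congr (ae_of_all _ fun y => ?_)
    simp
  have hev : Integrable (fun y => Complex.exp (Complex.I * θ * (φ y : ℝ)) * vθ θ y) μ :=
    hv.bdd_mul (c := 1) hgm.aestronglyMeasurable (ae_of_all _ fun y => (hn1 _).le)
  -- first part
  have P1 : ‖lam θ - ∫ y, Complex.exp (Complex.I * θ * (φ y : ℝ)) ∂μ‖ ≤ |K| * B * θ ^ (2 * β) := by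
    have e1 : lam θ - ∫ y, Complex.exp (Complex.I * θ * (φ y : ℝ)) ∂μ
        = ∫ y, (Complex.exp (Complex.I * θ * (φ y : ℝ)) - 1) * (vθ θ y - 1) ∂μ := by
      have : ∀ y, (Complex.exp (Complex.I * θ * (φ y : ℝ)) - 1) * (vθ θ y - 1)
          = (Complex.exp (Complex.I * θ * (φ y : ℝ)) * vθ θ y - Complex.exp (Complex.I * θ * (φ y : ℝ)))
            - (vθ θ y - 1) := fun y => by ring
      simp_rw [this]
      have hsub : Integrable (fun y => Complex.exp (Complex.I * θ * (φ y : ℝ)) * vθ θ y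
          - Complex.exp (Complex.I * θ * (φ y : ℝ))) μ := hev.sub hei
      rw [integral_sub hsub hv1, integral_sub hev hei, integral_sub hv (integrable_const _),
        hv_int θ hθ hθ1, hlam θ hθ hθ1]
      simp
    rw [e1]
    have hi : Integrable (fun y => ‖Complex.exp (Complex.I * θ * (φ y : ℝ)) - 1‖) μ :=
      (hei.sub (integrable_const (1:ℂ))).norm
    calc _ ≤ ∫ y, (|K| * θ ^ β) * ‖Complex.exp (Complex.I * θ * (φ y : ℝ)) - 1‖ ∂μ := by
          refine norm_integral_le_of_norm_le (hi.const_mul _) ?_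
          filter_upwards [hbd] with y hy
          rw [norm_mul, mul_comm]
          gcongr
          refine hy.trans ?_
          gcongr
          exact le_abs_self K
      _ = (|K| * θ ^ β) * ∫ y, ‖Complex.exp (Complex.I * θ * (φ y : ℝ)) - 1‖ ∂μ := integral_const_mul _ _
      _ ≤ (|K| * θ ^ β) * (B * θ ^ β) := by
          gcongr
          exact aux_small μ φ hφmeas β hβ1 hβ2 _ hS2 θ hθ
      _ = |K| * B * θ ^ (2 * β) := by
          rw [two_mul, Real.rpow_add hθ]; ring
  -- second part
  have hHi : IntegrableOn (fun x : ℝ => Complex.exp (Complex.I * θ * x) * (H₁ x : ℂ)) (Set.Ioi 0) := by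
    refine Integrable.bdd_mul (c := 1) hH₁int.ofReal hgc.aestronglyMeasurable (ae_of_all _ fun x => (hn1 x).le)
  have P2 : ‖(∫ x in Set.Ioi (0:ℝ), Complex.exp (Complex.I * θ * x) * (H₁ x : ℂ))
      - ((∫ x in Set.Ioi (0 : ℝ), H₁ x : ℝ) : ℂ)‖ ≤ C * D * θ ^ (r - 1) := by
    have hHc : IntegrableOn (fun x : ℝ => (H₁ x : ℂ)) (Set.Ioi 0) := hH₁int.ofReal
    rw [← integral_complex_ofReal, ← integral_sub hHi hHc]
    set f : ℝ → ℝ := fun u => ‖Complex.exp (Complex.I * u) - 1‖ * u ^ (-r) with hf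
    have hfi : IntegrableOn (fun x => f (θ * x)) (Set.Ioi 0) := by
      rw [integrableOn_Ioi_comp_mul_left_iff f 0 hθ, mul_zero]; exact hDint
    have hfv : ∫ x in Set.Ioi (0:ℝ), f (θ * x) = θ⁻¹ * D := by
      have := integral_comp_mul_left_Ioi f 0 hθ
      rwa [mul_zero, smul_eq_mul] at this
    calc _ ≤ ∫ x in Set.Ioi (0:ℝ), (C * θ ^ r) * f (θ * x) := by
          refine norm_integral_le_of_norm_le (hfi.const_mul _) ?_
          filter_upwards [ae_restrict_mem measurableSet_Ioi] with x hx
          have hx0 : 0 < x := hx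
          rw [← sub_one_mul, norm_mul, Complex.norm_real, Real.norm_eq_abs, hf]
          beta_reduce
          rw [Real.mul_rpow hθ.le hx0.le, Real.rpow_neg hθ.le, Complex.ofReal_mul, ← mul_assoc Complex.I]
          have h1 := (Real.rpow_pos_of_pos hθ r).ne'
          calc _ ≤ ‖Complex.exp (Complex.I * θ * x) - 1‖ * (C * x ^ (-r)) := by
                gcongr; exact hC x hx0
            _ = _ := by field_simp
      _ = (C * θ ^ r) * (θ⁻¹ * D) := by rw [integral_const_mul, hfv]
      _ = _ := by rw [Real.rpow_sub_one hθ.ne']; field_simp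
  have hrle : θ ^ r ≤ θ ^ (2 * β) + θ ^ q := by
    rcases min_choice q (1 + β) with h | h
    · rw [hr, h]
      have := Real.rpow_pos_of_pos hθ (2 * β)
      linarith
    · rw [hr, h]
      have h1 := Real.rpow_pos_of_pos hθ q
      have h2 : θ ^ (1 + β) ≤ θ ^ (2 * β) :=
        Real.rpow_le_rpow_of_exponent_ge hθ hθ2.le (by linarith)
      linarith
  have M := aux_main μ φ hφmeas β hβ1 hβ2 c H₁ hS hH₁int cβ hcβ θ hθ
  have hdec : lam θ - (1 - (c : ℂ) * cβ * ((θ ^ β : ℝ) : ℂ)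
          + Complex.I * c * ((∫ x in Set.Ioi (0 : ℝ), H₁ x : ℝ) : ℂ) * (θ : ℂ))
      = (lam θ - ∫ y, Complex.exp (Complex.I * θ * (φ y : ℝ)) ∂μ)
        + Complex.I * θ * c * ((∫ x in Set.Ioi (0:ℝ), Complex.exp (Complex.I * θ * x) * (H₁ x : ℂ))
      - ((∫ x in Set.Ioi (0 : ℝ), H₁ x : ℝ) : ℂ)) := by
    rw [M]; ring
  rw [hdec]
  have hq0 := Real.rpow_pos_of_pos hθ q
  have hb0 := Real.rpow_pos_of_pos hθ (2 * β)
  have P3 : ‖Complex.I * θ * c * ((∫ x in Set.Ioi (0:ℝ), Complex.exp (Complex.I * θ * x) * (H₁ x : ℂ))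
      - ((∫ x in Set.Ioi (0 : ℝ), H₁ x : ℝ) : ℂ))‖ ≤ c * C * D * (θ ^ (2 * β) + θ ^ q) := by
    rw [norm_mul, norm_mul, norm_mul, Complex.norm_I, Complex.norm_real, Complex.norm_real,
      Real.norm_eq_abs, Real.norm_eq_abs, abs_of_pos hθ, abs_of_pos hc, one_mul]
    calc _ ≤ θ * c * (C * D * θ ^ (r - 1)) := by gcongr
      _ = c * C * D * θ ^ r := by rw [Real.rpow_sub_one hθ.ne']; field_simp
      _ ≤ _ := by gcongr
  refine (norm_add_le _ _).trans ?_
  have : 0 ≤ |K| * B * θ ^ q := by positivity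
  linarith
end

section
/- Sine-transform asymptotics of a regularly varying tail: let (Y,μ) be a probability space, φ : Y → {1,2,3,…} measurable with μ(φ > n) = ℓ(n)/n for all n ≥ 1, where ℓ is slowly varying. Then lim_{θ→0⁺} ℓ(1/θ)^{−1} ∫_0^∞ sin(θx)·μ(φ > x) dx = π/2, where ∫_0^∞ is the improper integral lim_{M→∞} ∫_0^M and μ(φ > x) denotes the tail function x ↦ μ({y : φ(y) > x}). -/
open MeasureTheory Filter Topology

lemma aux_inner_t (x : ℝ) (hx : 0 < x) :
    IntegrableOn (fun t : ℝ => Real.exp (-(x * t))) (Set.Ioi 0) ∧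
      ∫ t in Set.Ioi (0:ℝ), Real.exp (-(x * t)) = 1 / x := by
  have h1 := integrableOn_exp_mul_Ioi (a := -x) (by linarith) 0
  have h2 := integral_exp_mul_Ioi (a := -x) (by linarith) 0
  simp only [neg_mul] at h1 h2
  refine ⟨h1, ?_⟩
  rw [h2]; simp

lemma aux_inner_x (A t : ℝ) :
    ∫ x in (0:ℝ)..A, Real.sin x * Real.exp (-(x * t)) =
      (1 - Real.exp (-(A * t)) * (Real.cos A + t * Real.sin A)) * (1 + t ^ 2)⁻¹ := by
  have hd : ∀ x ∈ Set.uIcc 0 A, HasDerivAt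
      (fun x => -(Real.exp (-(x * t)) * (Real.cos x + t * Real.sin x)) * (1 + t ^ 2)⁻¹)
      (Real.sin x * Real.exp (-(x * t))) x := by
    intro x _
    have he : HasDerivAt (fun x => Real.exp (-(x * t))) (Real.exp (-(x * t)) * (-(1 * t))) x :=
      (((hasDerivAt_id x).mul_const t).neg).exp
    have hc := (Real.hasDerivAt_cos x).add ((Real.hasDerivAt_sin x).const_mul t)
    have := ((he.mul hc).neg).mul_const ((1 + t ^ 2)⁻¹)
    refine HasDerivAt.congr_deriv this ?_
    have : (1 + t ^ 2) ≠ 0 := by positivity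
    simp only [Pi.add_apply]
    field_simp
    ring
  rw [intervalIntegral.integral_eq_sub_of_hasDerivAt hd]
  · simp; ring
  · apply Continuous.intervalIntegrable; fun_prop

lemma aux_dirichlet_eq (A : ℝ) (hA : 0 < A) :
    ∫ x in (0:ℝ)..A, Real.sin x / x =
      ∫ t in Set.Ioi (0:ℝ),
        (1 - Real.exp (-(A * t)) * (Real.cos A + t * Real.sin A)) * (1 + t ^ 2)⁻¹ := by
  have hint : Integrable (Function.uncurry fun x t : ℝ => Real.sin x * Real.exp (-(x * t)))
      ((volume.restrict (Set.Ioc 0 A)).prod (volume.restrict (Set.Ioi 0))) := by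
    rw [integrable_prod_iff]
    · constructor
      · filter_upwards [ae_restrict_mem measurableSet_Ioc] with x hx
        exact (aux_inner_t x hx.1).1.const_mul (Real.sin x)
      · have : IntegrableOn (fun _ : ℝ => (1:ℝ)) (Set.Ioc 0 A) := by simp
        refine Integrable.mono' this ?_ ?_
        · apply AEStronglyMeasurable.integral_prod_right' (f := fun p : ℝ × ℝ => ‖Function.uncurry (fun x t : ℝ => Real.sin x * Real.exp (-(x * t))) p‖)
          apply Continuous.aestronglyMeasurable
          simp only [Function.uncurry_def]; fun_prop
        · filter_upwards [ae_restrict_mem measurableSet_Ioc] with x hx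
          have h := (aux_inner_t x hx.1).2
          simp only [Function.uncurry, norm_mul, Real.norm_eq_abs, Real.abs_exp, integral_const_mul, h, abs_abs]
          rw [abs_of_nonneg (by have := hx.1; positivity : 0 ≤ 1 / x), mul_one_div, div_le_one hx.1]
          have := Real.abs_sin_le_abs (x := x)
          rwa [abs_of_pos hx.1] at this
    · apply Continuous.aestronglyMeasurable
      simp only [Function.uncurry_def]; fun_prop
  have hsw := integral_integral_swap hint
  calc ∫ x in (0:ℝ)..A, Real.sin x / x 
      = ∫ x in Set.Ioc 0 A, ∫ t in Set.Ioi (0:ℝ), Real.sin x * Real.exp (-(x * t)) := by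
        rw [intervalIntegral.integral_of_le hA.le]
        apply setIntegral_congr_fun measurableSet_Ioc
        intro x hx
        simp only [integral_const_mul, (aux_inner_t x hx.1).2, mul_one_div]
    _ = _ := by
        rw [hsw]
        congr 1; ext t
        rw [← intervalIntegral.integral_of_le hA.le, aux_inner_x]

lemma aux_dirichlet :
    Tendsto (fun A : ℝ => ∫ x in (0:ℝ)..A, Real.sin x / x) atTop (𝓝 (Real.pi / 2)) := by
  have h0 : ∫ t in Set.Ioi (0:ℝ), (1 + t ^ 2)⁻¹ = Real.pi / 2 := by
    rw [integral_Ioi_inv_one_add_sq]; simp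
  rw [← h0]
  have : Tendsto (fun A : ℝ => ∫ t in Set.Ioi (0:ℝ),
        (1 - Real.exp (-(A * t)) * (Real.cos A + t * Real.sin A)) * (1 + t ^ 2)⁻¹) atTop
        (𝓝 (∫ t in Set.Ioi (0:ℝ), (1 + t ^ 2)⁻¹)) := by
    have key : ∀ A t : ℝ, 0 < t → |Real.exp (-(A * t)) * (Real.cos A + t * Real.sin A)| ≤
        Real.exp (-(A * t)) * (1 + t) := by
      intro A t ht
      rw [abs_mul, Real.abs_exp]
      gcongr
      refine (abs_add_le _ _).trans ?_
      rw [abs_mul, abs_of_pos ht]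
      have := Real.abs_cos_le_one A
      have := Real.abs_sin_le_one A
      nlinarith
    apply tendsto_integral_filter_of_dominated_convergence (fun t => 2 * (1 + t ^ 2)⁻¹)
    · filter_upwards with A
      apply Continuous.aestronglyMeasurable
      have : ∀ t : ℝ, 1 + t ^ 2 ≠ 0 := fun t => by positivity
      fun_prop (disch := assumption)
    · filter_upwards [eventually_ge_atTop 1] with A hA
      filter_upwards [ae_restrict_mem measurableSet_Ioi] with t ht
      have ht : 0 < t := ht
      rw [norm_mul, Real.norm_eq_abs, Real.norm_eq_abs, abs_of_pos (by positivity : 0 < (1 + t ^ 2)⁻¹)]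
      gcongr
      refine (abs_sub _ _).trans ?_
      have h1 := key A t ht
      have h2 : Real.exp (-(A * t)) * (1 + t) ≤ 1 := by
        calc Real.exp (-(A * t)) * (1 + t) ≤ Real.exp (-t) * Real.exp t := by
              gcongr
              · nlinarith
              · linarith [Real.add_one_le_exp t]
          _ = 1 := by rw [← Real.exp_add]; simp
      simp only [abs_one]; linarith
    · exact (integrable_inv_one_add_sq.const_mul 2).integrableOn
    · filter_upwards [ae_restrict_mem measurableSet_Ioi] with t ht
      have ht : 0 < t := ht
      have : Tendsto (fun A : ℝ => Real.exp (-(A * t)) * (Real.cos A + t * Real.sin A)) atTop (𝓝 0) := by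
        apply squeeze_zero_norm (a := fun A => Real.exp (-(A * t)) * (1 + t)) (fun A => key A t ht)
        have : Tendsto (fun A : ℝ => Real.exp (-(A * t))) atTop (𝓝 0) :=
          Real.tendsto_exp_neg_atTop_nhds_zero.comp (tendsto_id.atTop_mul_const ht)
        simpa using this.mul_const (1 + t)
      simpa using ((tendsto_const_nhds (x := (1:ℝ))).sub this).mul_const ((1 + t ^ 2)⁻¹)
  refine this.congr' ?_
  filter_upwards [eventually_gt_atTop 0] with A hA
  rw [aux_dirichlet_eq A hA]

lemma aux_min_add (a b : ℝ) : min |a + b| 1 ≤ min |a| 1 + min |b| 1 := by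
  have := abs_add_le a b
  have := abs_nonneg a
  have := abs_nonneg b
  rcases min_cases |a| 1 with h | h <;> rcases min_cases |b| 1 with h' | h' <;>
  rcases min_cases |a + b| 1 with h'' | h'' <;> linarith

lemma aux_uct (f : ℝ → ℝ) (hf : Measurable f)
    (h : ∀ s, Tendsto (fun x => f (x + s) - f x) atTop (𝓝 0))
    (y : ℝ → ℝ) (hy : Tendsto y atTop atTop) (hy1 : ∀ᶠ x in atTop, y x ≤ x)
    (hy2 : ∀ᶠ x in atTop, x ≤ y x + 1) :
    Tendsto (fun x => f x - f (y x)) atTop (𝓝 0) := by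
  set k : ℝ → ℝ → ℝ := fun x s => min |f (x + s) - f x| 1 with hk
  have hkm : ∀ x, Measurable (k x) := fun x => by simp only [hk]; fun_prop
  have hk0 : ∀ x s, 0 ≤ k x s := fun x s => le_min (abs_nonneg _) zero_le_one
  have hk1 : ∀ x s, k x s ≤ 1 := fun x s => min_le_right _ _
  have hii : ∀ x a b, IntervalIntegrable (k x) volume a b := by
    intro x a b
    apply IntervalIntegrable.mono_fun' (g := fun _ => (1:ℝ)) intervalIntegrable_const (hkm x).aestronglyMeasurable
    filter_upwards with s
    rw [Real.norm_eq_abs, abs_of_nonneg (hk0 x s)]; exact hk1 x s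
  set I : ℝ → ℝ := fun x => ∫ s in (0:ℝ)..2, k x s with hI
  have hI0 : Tendsto I atTop (𝓝 0) := by
    have : Tendsto I atTop (𝓝 (∫ s in (0:ℝ)..2, (0:ℝ))) := by
      apply intervalIntegral.tendsto_integral_filter_of_dominated_convergence (fun _ => (1:ℝ))
      · filter_upwards with x
        exact (hkm x).aestronglyMeasurable
      · filter_upwards with x
        filter_upwards with s _
        rw [Real.norm_eq_abs, abs_of_nonneg (hk0 x s)]; exact hk1 x s
      · exact intervalIntegrable_const
      · filter_upwards with s _
        have := (h s).abs.min (tendsto_const_nhds (x := (1:ℝ)))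
        simpa using this
    simpa using this
  have main : ∀ x u, 0 ≤ u → u ≤ 1 → min |f (x + u) - f x| 1 ≤ I x + I (x + u) := by
    intro x u hu0 hu1
    have e1 : ∫ s in (1:ℝ)..2, min |f (x + u) - f x| 1 = min |f (x + u) - f x| 1 := by
      simp; norm_num
    have e2 : ∫ s in (1:ℝ)..2, k (x + u) (s - u) = ∫ s in (1 - u)..(2 - u), k (x + u) s := by
      rw [intervalIntegral.integral_comp_sub_right]
    have hi2 : IntervalIntegrable (fun s => k (x + u) (s - u)) volume 1 2 := by
      have := (hii (x + u) (1 - u) (2 - u)).comp_sub_right u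
      simpa using this
    have e3 : ∫ s in (1:ℝ)..2, min |f (x + u) - f x| 1 ≤ ∫ s in (1:ℝ)..2, (k x s + k (x + u) (s - u)) := by
      apply intervalIntegral.integral_mono_on (by norm_num) intervalIntegrable_const ((hii x 1 2).add hi2)
      intro s _
      have := aux_min_add (f (x + s) - f x) (-(f (x + s) - f (x + u)))
      rw [abs_neg] at this
      simp only [hk]
      convert this using 3
      · ring_nf
      · ring_nf
    rw [intervalIntegral.integral_add (hii x 1 2) hi2, e1, e2] at e3
    have e4 : ∫ s in (1:ℝ)..2, k x s ≤ I x := by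
      apply intervalIntegral.integral_mono_interval (by norm_num) (by norm_num) (by norm_num)
      · filter_upwards with s; exact hk0 x s
      · exact hii _ _ _
    have e5 : ∫ s in (1 - u)..(2 - u), k (x + u) s ≤ I (x + u) := by
      apply intervalIntegral.integral_mono_interval (by linarith) (by linarith) (by linarith)
      · filter_upwards with s; exact hk0 _ s
      · exact hii _ _ _
    linarith
  have hlim : Tendsto (fun x => min |f x - f (y x)| 1) atTop (𝓝 0) := by
    apply squeeze_zero' (g := fun x => I (y x) + I x)
    · filter_upwards with x; exact le_min (abs_nonneg _) zero_le_one
    · filter_upwards [hy1, hy2] with x h1 h2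
      have := main (y x) (x - y x) (by linarith) (by linarith)
      simpa using this
    · simpa using (hI0.comp hy).add hI0
  rw [tendsto_zero_iff_abs_tendsto_zero]
  refine hlim.congr' ?_
  have := hlim.eventually (gt_mem_nhds (zero_lt_one))
  filter_upwards [this] with x hx
  rcases min_lt_iff.1 hx with h | h
  · exact min_eq_left h.le
  · exact absurd h (lt_irrefl _)

lemma aux_floor (l : ℝ → ℝ) (hl : SlowlyVarying l) (hpos : ∀ x, 0 < x → 0 < l x) :
    Tendsto (fun x : ℝ => l (⌊x⌋₊ : ℝ) / l x) atTop (𝓝 1) := by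
  obtain ⟨hm, -, hs⟩ := hl
  set f : ℝ → ℝ := fun t => Real.log (l (Real.exp t)) with hf
  have hfl : ∀ t x, 0 < x → 0 < t → f (Real.log t) - f (Real.log x) = Real.log (l t / l x) := by
    intro t x hx ht
    simp only [hf]
    rw [Real.exp_log hx, Real.exp_log ht, Real.log_div (hpos t ht).ne' (hpos x hx).ne']
  have h1 : ∀ s, Tendsto (fun x => f (x + s) - f x) atTop (𝓝 0) := by
    intro s
    have := ((hs (Real.exp s) (Real.exp_pos s)).comp Real.tendsto_exp_atTop).log one_ne_zero
    rw [Real.log_one] at this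
    refine this.congr fun x => ?_
    simp only [hf, Function.comp]
    rw [Real.log_div (hpos _ (by positivity)).ne' (hpos _ (by positivity)).ne', Real.exp_add, mul_comm]
  have hfloor : Tendsto (fun x : ℝ => ((⌊x⌋₊ : ℕ) : ℝ)) atTop atTop :=
    tendsto_natCast_atTop_atTop.comp tendsto_nat_floor_atTop
  have h2 := aux_uct f (by fun_prop) h1 (fun t => Real.log (⌊Real.exp t⌋₊ : ℝ))
    (Real.tendsto_log_atTop.comp (hfloor.comp Real.tendsto_exp_atTop))
    (by
      filter_upwards [eventually_ge_atTop 0] with t ht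
      have h1 : 1 ≤ Real.exp t := Real.one_le_exp ht
      have : 1 ≤ ⌊Real.exp t⌋₊ := by rwa [Nat.one_le_floor_iff]
      rw [Real.log_le_iff_le_exp (by positivity)]
      exact Nat.floor_le (by positivity))
    (by
      filter_upwards [eventually_ge_atTop 0] with t ht
      have h1 : 1 ≤ Real.exp t := Real.one_le_exp ht
      have h3 : 1 ≤ ⌊Real.exp t⌋₊ := by rwa [Nat.one_le_floor_iff]
      have h3' : (1:ℝ) ≤ ⌊Real.exp t⌋₊ := by exact_mod_cast h3
      have h4 := Nat.lt_floor_add_one (Real.exp t)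
      rw [← sub_le_iff_le_add, Real.le_log_iff_exp_le (by positivity), Real.exp_sub]
      rw [div_le_iff₀ (by positivity)]
      nlinarith [Real.add_one_le_exp (1:ℝ)])
  have h3 := (h2.comp Real.tendsto_log_atTop).neg.rexp
  rw [neg_zero, Real.exp_zero] at h3
  refine h3.congr' ?_
  filter_upwards [eventually_ge_atTop 1] with x hx
  have hx0 : 0 < x := by linarith
  have h3 : 0 < ⌊x⌋₊ := by rwa [Nat.floor_pos]
  simp only [Function.comp, Real.exp_log hx0, neg_sub]
  rw [hfl _ _ hx0 (by positivity), Real.exp_log]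
  exact div_pos (hpos _ (by positivity)) (hpos _ hx0)

lemma aux_inner_sin (A z : ℝ) (hA : 0 ≤ A) (hz : 0 ≤ z) :
    ∫ u in Set.Ioc 0 A, Real.sin u * (Set.Iio z).indicator (fun _ => (1:ℝ)) u
      = 1 - Real.cos (min A z) := by
  have h1 : ∀ u, Real.sin u * (Set.Iio z).indicator (fun _ => (1:ℝ)) u =
      (Set.Iio z).indicator Real.sin u := by
    intro u; by_cases h : u ∈ Set.Iio z <;> simp [h]
  simp_rw [h1]
  rw [setIntegral_indicator measurableSet_Iio]
  have : (Set.Ioc 0 A ∩ Set.Iio z : Set ℝ) =ᵐ[volume] Set.Ioc 0 (min A z) := by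
    rw [← Set.Ioc_inter_Iic]
    exact (ae_eq_refl _).inter Iio_ae_eq_Iic
  rw [setIntegral_congr_set this, ← intervalIntegral.integral_of_le (le_min hA hz), integral_sin]
  simp

lemma aux_fubini_s14 {Y : Type*} [MeasurableSpace Y] (μ : Measure Y) [IsProbabilityMeasure μ]
    (Z : Y → ℝ) (hZ : Measurable Z) (hZ0 : ∀ y, 0 ≤ Z y) (A : ℝ) (hA : 0 ≤ A) :
    ∫ u in (0:ℝ)..A, Real.sin u * (μ {y | u < Z y}).toReal
      = ∫ y, (1 - Real.cos (min A (Z y))) ∂μ := by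
  rw [intervalIntegral.integral_of_le hA]
  have hms : MeasurableSet {p : ℝ × Y | p.1 < Z p.2} :=
    measurableSet_lt measurable_fst (hZ.comp measurable_snd)
  have hint : Integrable (Function.uncurry fun (u : ℝ) (y : Y) =>
      Real.sin u * (Set.Iio (Z y)).indicator (fun _ => (1:ℝ)) u)
      ((volume.restrict (Set.Ioc 0 A)).prod μ) := by
    refine Integrable.mono' (g := fun _ => (1:ℝ)) (integrable_const _) ?_ ?_
    · apply Measurable.aestronglyMeasurable
      have : (Function.uncurry fun (u : ℝ) (y : Y) =>
        Real.sin u * (Set.Iio (Z y)).indicator (fun _ => (1:ℝ)) u) =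
        fun p => Real.sin p.1 * {p : ℝ × Y | p.1 < Z p.2}.indicator (fun _ => (1:ℝ)) p := by
        ext ⟨u, y⟩; simp [Function.uncurry, Set.indicator]
      rw [this]
      exact (Real.measurable_sin.comp measurable_fst).mul (measurable_const.indicator hms)
    · filter_upwards with p
      simp only [Function.uncurry, norm_mul, Real.norm_eq_abs]
      have h1 := Real.abs_sin_le_one p.1
      by_cases h : p.1 ∈ Set.Iio (Z p.2) <;> simp [h, h1]
  have hsw := integral_integral_swap hint
  simp_rw [aux_inner_sin A _ hA (hZ0 _)] at hsw
  rw [← hsw]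
  congr 1; ext u
  rw [integral_const_mul]
  congr 1
  have : (fun y => (Set.Iio (Z y)).indicator (fun _ => (1:ℝ)) u) = {y | u < Z y}.indicator 1 := by
    ext y; simp [Set.indicator]
  rw [this, integral_indicator_one (measurableSet_lt measurable_const hZ)]
  rfl

lemma aux_err {Y : Type*} [MeasurableSpace Y] (μ : Measure Y) [IsProbabilityMeasure μ]
    (Z : Y → ℝ) (hZ : Measurable Z) (hZ0 : ∀ y, 0 ≤ Z y) (A : ℝ) (hA : 0 ≤ A) :
    |(∫ u in (0:ℝ)..A, Real.sin u * (μ {y | u < Z y}).toReal)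
      - ∫ y, (1 - Real.cos (Z y)) ∂μ| ≤ 2 * (μ {y | A < Z y}).toReal := by
  have hb : ∀ W : Y → ℝ, Measurable W → Integrable (fun y => 1 - Real.cos (W y)) μ := by
    intro W hW
    refine Integrable.mono' (g := fun _ => (2:ℝ)) (integrable_const _) (by fun_prop) ?_
    filter_upwards with y
    rw [Real.norm_eq_abs, abs_le]
    constructor <;> linarith [Real.neg_one_le_cos (W y), Real.cos_le_one (W y)]
  rw [aux_fubini_s14 μ Z hZ hZ0 A hA, ← integral_sub (hb _ (by fun_prop)) (hb _ hZ)]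
  have hms : MeasurableSet {y | A < Z y} := measurableSet_lt measurable_const hZ
  have : 2 * (μ {y | A < Z y}).toReal = ∫ y, {y | A < Z y}.indicator (fun _ => (2:ℝ)) y ∂μ := by
    rw [integral_indicator_const _ hms]; simp [Measure.real, mul_comm]
  rw [this]
  apply norm_integral_le_of_norm_le (f := fun y => (1 - Real.cos (min A (Z y))) - (1 - Real.cos (Z y)))
  · exact (integrable_const _).indicator hms
  · filter_upwards with y
    by_cases h : A < Z y
    · have : y ∈ {y | A < Z y} := h
      rw [Set.indicator_of_mem this, Real.norm_eq_abs, abs_le]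
      constructor <;> linarith [Real.neg_one_le_cos (Z y), Real.cos_le_one (Z y), Real.neg_one_le_cos (min A (Z y)), Real.cos_le_one (min A (Z y))]
    · have h' : y ∉ {y | A < Z y} := h
      rw [Set.indicator_of_notMem h', min_eq_right (not_lt.1 h)]; simp

lemma aux_potter (T : ℝ → ℝ) (hanti : Antitone T) (hT1 : ∀ x, T x ≤ 1) (hpos : ∀ x, 0 < T x)
    (hrv : Tendsto (fun x => T (2 * x) / T x) atTop (𝓝 (1 / 2))) :
    ∃ C > 0, ∀ᶠ X in atTop, ∀ u, 0 < u → u ≤ 1 →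
      T (u * X) ≤ C * (1 / u) ^ (3 / 2 : ℝ) * T X := by
  set c : ℝ := 2 ^ (3 / 2 : ℝ) with hc
  have hc2 : 2 < c := by
    have : (2:ℝ) ^ (1:ℝ) < 2 ^ (3 / 2 : ℝ) :=
      Real.rpow_lt_rpow_of_exponent_lt (by norm_num) (by norm_num)
    simpa using this
  have hc0 : 0 < c := by linarith
  have hlt : 1 / c < 1 / 2 := one_div_lt_one_div_of_lt (by norm_num) hc2
  obtain ⟨X1, hX1⟩ := eventually_atTop.1 (hrv.eventually (lt_mem_nhds hlt))
  set X0 := max X1 1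
  have hX0 : 1 ≤ X0 := le_max_right _ _
  have hstep : ∀ x, X0 ≤ x → T x ≤ c * T (2 * x) := by
    intro x hx
    have := hX1 x ((le_max_left _ _).trans hx)
    rw [div_lt_div_iff₀ hc0 (hpos x)] at this
    linarith
  have hiter : ∀ k : ℕ, ∀ x, X0 ≤ x → T x ≤ c ^ k * T (2 ^ k * x) := by
    intro k
    induction k with
    | zero => intro x _; simp
    | succ k ih =>
      intro x hx
      have h1 := ih x hx
      have h2 : 1 ≤ (2:ℝ) ^ k := one_le_pow₀ (by norm_num)
      have h3 := hstep (2 ^ k * x) (by nlinarith)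
      calc T x ≤ c ^ k * T (2 ^ k * x) := h1
        _ ≤ c ^ k * (c * T (2 * (2 ^ k * x))) := by gcongr
        _ = _ := by rw [← mul_assoc, ← mul_assoc, ← pow_succ, ← pow_succ']
  have hP : ∀ x y, X0 ≤ x → x ≤ y → T x ≤ c * (y / x) ^ (3 / 2 : ℝ) * T y := by
    intro x y hx hxy
    have hx0 : 0 < x := by linarith
    obtain ⟨n, hn1, hn2⟩ := exists_nat_pow_near ((one_le_div hx0).2 hxy) (one_lt_two (α := ℝ))
    have h1 := hiter (n + 1) x hx
    have h2 : T (2 ^ (n + 1) * x) ≤ T y := hanti (by rw [div_lt_iff₀ hx0] at hn2; exact hn2.le)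
    have h3 : c ^ n ≤ (y / x) ^ (3 / 2 : ℝ) := by
      have : c ^ n = ((2:ℝ) ^ n) ^ (3 / 2 : ℝ) := by
        rw [hc, ← Real.rpow_natCast, ← Real.rpow_mul (by norm_num), ← Real.rpow_natCast,
          ← Real.rpow_mul (by norm_num), mul_comm]
      rw [this]
      gcongr
    have := hpos y
    calc T x ≤ c ^ (n + 1) * T (2 ^ (n + 1) * x) := h1
      _ ≤ c ^ (n + 1) * T y := by gcongr
      _ = c * c ^ n * T y := by rw [pow_succ']
      _ ≤ _ := by gcongr
  refine ⟨c / T X0, div_pos hc0 (hpos _), ?_⟩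
  filter_upwards [eventually_ge_atTop X0] with X hX u hu hu1
  have hXpos : 0 < X := by linarith
  set x := max (u * X) X0 with hx
  have hxX : x ≤ X := max_le (by nlinarith) hX
  have hxX0 : X0 ≤ x := le_max_right _ _
  have hxpos : 0 < x := by linarith
  have h1 := hP x X hxX0 hxX
  have h2 : X / x ≤ 1 / u := by
    rw [div_le_div_iff₀ hxpos hu]
    have : u * X ≤ x := le_max_left _ _
    linarith
  have h3 : T (u * X) ≤ T x / T X0 := by
    rcases le_total (u * X) X0 with h | h
    · have : x = X0 := max_eq_right h
      rw [this, div_self (hpos _).ne']; exact hT1 _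
    · have : x = u * X := max_eq_left h
      rw [this, le_div_iff₀ (hpos _)]
      have := hpos (u * X); have := hT1 X0
      nlinarith
  have := hpos X
  have := hpos X0
  calc T (u * X) ≤ T x / T X0 := h3
    _ ≤ (c * (X / x) ^ (3 / 2 : ℝ) * T X) / T X0 := by gcongr
    _ ≤ (c * (1 / u) ^ (3 / 2 : ℝ) * T X) / T X0 := by gcongr
    _ = _ := by ring

lemma aux_finite (T : ℝ → ℝ) (hanti : Antitone T) (hT1 : ∀ x, T x ≤ 1) (hpos : ∀ x, 0 < T x)
    (hrv : ∀ a : ℝ, 0 < a → Tendsto (fun x => T (a * x) / T x) atTop (𝓝 (1 / a)))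
    (A : ℝ) (hA : 0 < A) :
    Tendsto (fun X => ∫ u in (0:ℝ)..A, Real.sin u * (T (u * X) / T X)) atTop
      (𝓝 (∫ u in (0:ℝ)..A, Real.sin u / u)) := by
  obtain ⟨C, hC, hP⟩ := aux_potter T hanti hT1 hpos (hrv 2 two_pos)
  apply intervalIntegral.tendsto_integral_filter_of_dominated_convergence
    (fun u => C * u ^ (-(1 / 2) : ℝ) + 1)
  · filter_upwards with X
    apply Measurable.aestronglyMeasurable
    have := hanti.measurable
    fun_prop
  · filter_upwards [hP, eventually_gt_atTop 0] with X hX hX0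
    filter_upwards with u hu
    rw [Set.uIoc_of_le hA.le] at hu
    have hu0 := hu.1
    have hnn : 0 ≤ T (u * X) / T X := div_nonneg (hpos _).le (hpos _).le
    rw [norm_mul, Real.norm_eq_abs, Real.norm_eq_abs, abs_of_nonneg hnn]
    have hCu : 0 ≤ C * u ^ (-(1 / 2) : ℝ) := by positivity
    rcases le_total u 1 with h | h
    · have h1 : |Real.sin u| ≤ u := by
        have := Real.abs_sin_le_abs (x := u)
        rwa [abs_of_pos hu0] at this
      have h2 : T (u * X) / T X ≤ C * (1 / u) ^ (3 / 2 : ℝ) := by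
        rw [div_le_iff₀ (hpos _)]; exact hX u hu0 h
      have h3 : u * (C * (1 / u) ^ (3 / 2 : ℝ)) = C * u ^ (-(1 / 2) : ℝ) := by
        have e : u ^ (-(1 / 2) : ℝ) = u * u ^ (-(3 / 2) : ℝ) := by
          nth_rw 2 [← Real.rpow_one u]
          rw [← Real.rpow_add hu0]; norm_num
        rw [e, one_div, Real.inv_rpow hu0.le, Real.rpow_neg hu0.le]; ring
      calc |Real.sin u| * (T (u * X) / T X) ≤ u * (C * (1 / u) ^ (3 / 2 : ℝ)) := by gcongr
        _ ≤ _ := by rw [h3]; linarith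
    · have h2 : T (u * X) / T X ≤ 1 := by
        rw [div_le_one (hpos _)]; exact hanti (by nlinarith)
      have := Real.abs_sin_le_one u
      calc |Real.sin u| * (T (u * X) / T X) ≤ 1 * 1 := by gcongr
        _ ≤ _ := by linarith
  · apply IntervalIntegrable.add _ intervalIntegrable_const
    exact (intervalIntegral.intervalIntegrable_rpow' (by norm_num)).const_mul C
  · filter_upwards with u hu
    rw [Set.uIoc_of_le hA.le] at hu
    simpa [div_eq_mul_inv] using (hrv u hu.1).const_mul (Real.sin u)

lemma aux_main_s14 {Y : Type*} [MeasurableSpace Y] (μ : Measure Y) [IsProbabilityMeasure μ]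
    (Z : Y → ℝ) (hZ : Measurable Z) (hZ0 : ∀ y, 0 ≤ Z y)
    (T : ℝ → ℝ) (hT : ∀ x, T x = (μ {y | x < Z y}).toReal)
    (hanti : Antitone T) (hT1 : ∀ x, T x ≤ 1) (hpos : ∀ x, 0 < T x)
    (hrv : ∀ a : ℝ, 0 < a → Tendsto (fun x => T (a * x) / T x) atTop (𝓝 (1 / a))) :
    Tendsto (fun X => (∫ y, (1 - Real.cos (Z y / X)) ∂μ) / T X) atTop (𝓝 (Real.pi / 2)) := by
  have herr : ∀ A X, 0 < A → 0 < X → |(∫ u in (0:ℝ)..A, Real.sin u * (T (u * X) / T X))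
      - (∫ y, (1 - Real.cos (Z y / X)) ∂μ) / T X| ≤ 2 * (T (A * X) / T X) := by
    intro A X hA hX
    have h := aux_err μ (fun y => Z y / X) (hZ.div_const X) (fun y => div_nonneg (hZ0 y) hX.le) A hA.le
    have e : ∀ u, (μ {y | u < Z y / X}).toReal = T (u * X) := by
      intro u; rw [hT]; simp only [lt_div_iff₀ hX]
    simp only [e] at h
    have e2 : (∫ u in (0:ℝ)..A, Real.sin u * (T (u * X) / T X)) =
        (∫ u in (0:ℝ)..A, Real.sin u * T (u * X)) / T X := by
      rw [← intervalIntegral.integral_div]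
      congr 1; ext u; ring
    rw [e2, ← sub_div, abs_div, abs_of_pos (hpos X), ← mul_div_assoc]
    have := hpos X
    gcongr
  rw [Metric.tendsto_atTop']
  intro ε hε
  have hD := aux_dirichlet.eventually (Metric.ball_mem_nhds _ (by positivity : 0 < ε / 4))
  obtain ⟨A, hA1, hA2⟩ := (hD.and (eventually_gt_atTop (max 0 (16 / ε)))).exists
  have hA0 : 0 < A := (le_max_left _ _).trans_lt hA2
  have hA3 : 16 / ε < A := (le_max_right _ _).trans_lt hA2
  have hA4 : 1 / A < ε / 16 := by
    rw [div_lt_div_iff₀ hA0 (by norm_num)]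
    rw [div_lt_iff₀ hε] at hA3; linarith
  have h1 := (aux_finite T hanti hT1 hpos hrv A hA0).eventually
    (Metric.ball_mem_nhds _ (by positivity : 0 < ε / 4))
  have h2 := (hrv A hA0).eventually (gt_mem_nhds hA4)
  have h3 := h1.and (h2.and (eventually_gt_atTop 0))
  obtain ⟨N, hN⟩ := eventually_atTop.1 h3
  refine ⟨N, fun X hX => ?_⟩
  obtain ⟨g1, g2, g3⟩ := hN X hX.le
  have g4 := herr A X hA0 g3
  rw [Real.dist_eq, abs_lt] at g1 hA1
  rw [Real.dist_eq, abs_lt]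
  rw [abs_le] at g4
  constructor <;> linarith [g1.1, g1.2, hA1.1, hA1.2, g4.1, g4.2]

theorem sine_transform_asymptotics
    {Y : Type*} [MeasurableSpace Y] (μ : Measure Y) [IsProbabilityMeasure μ]
    (φ : Y → ℕ) (hφmeas : Measurable φ) (hφpos : ∀ y, 1 ≤ φ y)
    (l : ℝ → ℝ) (hl : SlowlyVarying l)
    (htail : ∀ n : ℕ, 1 ≤ n → (μ {y | n < φ y}).toReal = l n / n) :
    ∃ S : ℝ → ℝ,
      (∀ θ : ℝ, 0 < θ →
        Tendsto (fun M : ℝ =>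
            ∫ x in (0 : ℝ)..M, Real.sin (θ * x) * (μ {y | x < (φ y : ℝ)}).toReal)
          atTop (𝓝 (S θ))) ∧
      Tendsto (fun θ : ℝ => (l (1 / θ))⁻¹ * S θ) (𝓝[>] (0 : ℝ))
        (𝓝 (Real.pi / 2)) := by
  have hlpos : ∀ x, 0 < x → 0 < l x := by
    intro x hx
    obtain ⟨c, C, hc, h⟩ := hl.2.1 {x} isCompact_singleton (by simpa using hx)
    exact hc.trans_le (h x rfl).1
  have hfl := aux_floor l hl hlpos
  set Z : Y → ℝ := fun y => (φ y : ℝ) with hZdef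
  have hZ : Measurable Z := measurable_from_nat.comp hφmeas
  have hZ0 : ∀ y, 0 ≤ Z y := fun y => Nat.cast_nonneg _
  obtain ⟨T, hT⟩ : ∃ T : ℝ → ℝ, ∀ x, T x = (μ {y | x < Z y}).toReal := ⟨_, fun _ => rfl⟩
  have hanti : Antitone T := by
    intro a b hab
    rw [hT, hT]
    exact ENNReal.toReal_mono (measure_ne_top _ _)
      (measure_mono fun y (hy : b < Z y) => lt_of_le_of_lt hab hy)
  have hT1 : ∀ x, T x ≤ 1 := by
    intro x; rw [hT]; exact ENNReal.toReal_mono ENNReal.one_ne_top prob_le_one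
  have hTf : ∀ x, 1 ≤ x → T x = l (⌊x⌋₊ : ℝ) / (⌊x⌋₊ : ℝ) := by
    intro x hx
    rw [hT, ← htail _ (by rwa [Nat.one_le_floor_iff])]
    congr 2
    ext y
    simp only [Set.mem_ofPred_eq, hZdef]
    rw [Nat.floor_lt (by linarith)]
  have hpos : ∀ x, 0 < T x := by
    intro x
    have h1 : T (max x 1) ≤ T x := hanti (le_max_left _ _)
    refine lt_of_lt_of_le ?_ h1
    rw [hTf _ (le_max_right _ _)]
    have : 0 < ⌊max x 1⌋₊ := by rw [Nat.floor_pos]; exact le_max_right _ _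
    exact div_pos (hlpos _ (by positivity)) (by positivity)
  have hfloor : Tendsto (fun x : ℝ => (⌊x⌋₊ : ℝ) / x) atTop (𝓝 1) := tendsto_nat_floor_div_atTop
  -- `x T(x) / l x → 1`
  have hq : Tendsto (fun x => x * T x / l x) atTop (𝓝 1) := by
    have := hfl.div hfloor one_ne_zero
    rw [div_one] at this
    refine this.congr' ?_
    filter_upwards [eventually_ge_atTop 1] with x hx
    have h0 : 0 < ⌊x⌋₊ := by rwa [Nat.floor_pos]
    have h0' : (0:ℝ) < ⌊x⌋₊ := by exact_mod_cast h0
    have h1 := hlpos x (by linarith)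
    rw [Pi.div_apply, hTf x hx]
    field_simp
  have hrv : ∀ a : ℝ, 0 < a → Tendsto (fun x => T (a * x) / T x) atTop (𝓝 (1 / a)) := by
    intro a ha
    have h1 : Tendsto (fun x : ℝ => a * x) atTop atTop := tendsto_id.const_mul_atTop ha
    have h2 := (((hq.comp h1).mul (hl.2.2 a ha)).div hq one_ne_zero).mul_const (1 / a)
    simp only [mul_one, div_one, one_mul] at h2
    refine h2.congr' ?_
    filter_upwards [eventually_gt_atTop 0] with x hx
    have g1 := (hlpos x hx).ne'
    have g2 := (hlpos (a * x) (by positivity)).ne'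
    have g3 := (hpos x).ne'
    simp only [Pi.div_apply, Function.comp]
    field_simp
  have hmain := aux_main_s14 μ Z hZ hZ0 T hT hanti hT1 hpos hrv
  refine ⟨fun θ => θ⁻¹ * ∫ y, (1 - Real.cos (θ * Z y)) ∂μ, ?_, ?_⟩
  · intro θ hθ
    have hT0 : Tendsto T atTop (𝓝 0) := by
      have hcomp : T = fun x => (μ {y | x < Z y}).toReal := funext hT
      have h2 := hrv 2 two_pos
      have hbdd : BddBelow (Set.range T) := ⟨0, by rintro _ ⟨x, rfl⟩; exact (hpos x).le⟩
      have h3 := tendsto_atTop_ciInf hanti hbdd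
      by_cases hz : (⨅ x, T x) = 0
      · rwa [hz] at h3
      · exfalso
        have h4 : Tendsto (fun x : ℝ => 2 * x) atTop atTop := tendsto_id.const_mul_atTop two_pos
        have h5 := (h3.comp h4).div h3 hz
        rw [div_self hz] at h5
        have := tendsto_nhds_unique h2 h5
        norm_num at this
    rw [tendsto_iff_norm_sub_tendsto_zero]
    have hb : Tendsto (fun M => θ⁻¹ * (2 * T M)) atTop (𝓝 0) := by
      simpa using (hT0.const_mul 2).const_mul θ⁻¹
    apply squeeze_zero' (Eventually.of_forall fun _ => norm_nonneg _) _ hb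
    filter_upwards [eventually_ge_atTop 0] with M hM
    have h := aux_err μ (fun y => θ * Z y) (hZ.const_mul θ) (fun y => mul_nonneg hθ.le (hZ0 y))
      (θ * M) (by positivity)
    have e1 : ∀ x, (μ {y | θ * x < θ * Z y}).toReal = T x := by
      intro x; rw [hT]; simp only [mul_lt_mul_iff_right₀ hθ]
    have e2 := intervalIntegral.integral_comp_mul_left
      (a := 0) (b := M) (fun u => Real.sin u * (μ {y | u < θ * Z y}).toReal) hθ.ne'
    simp only [e1, mul_zero, smul_eq_mul] at e2 h
    have e3 : ∀ x, (μ {y | x < (φ y : ℝ)}).toReal = T x := fun x => (hT x).symm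
    simp only [e3]
    rw [e2, ← mul_sub, norm_mul, Real.norm_eq_abs, Real.norm_eq_abs, abs_of_pos (inv_pos.2 hθ)]
    gcongr
  · have h := (hq.mul hmain).comp tendsto_inv_nhdsGT_zero
    rw [one_mul] at h
    refine h.congr' ?_
    filter_upwards [self_mem_nhdsWithin] with θ hθ
    have hθ : 0 < θ := hθ
    have g3 := (hpos θ⁻¹).ne'
    have g1 := (hlpos θ⁻¹ (by positivity)).ne'
    have e : ∀ y, Z y / θ⁻¹ = θ * Z y := fun y => by rw [div_inv_eq_mul, mul_comm]
    simp only [Function.comp, e, one_div]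
    generalize T θ⁻¹ = p at *
    generalize l θ⁻¹ = q at *
    field_simp
end
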